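/- Let (X, ℝ, α) be a nontrivial one-parameter C*-dynamical system such that X^α([0,∞)) is a maximal norm-closed subalgebra of X. If 0 is an isolated point of sp(α), then Condition 4.3 is satisfied. -/

import Mathlib

open MeasureTheory Set Filter Topology Pointwise

noncomputable section

namespace PeligradMax

variable {X : Type*} [NonUnitalNormedRing X] [StarRing X] [CStarRing X]
  [NormedSpace ℂ X] [IsScalarTower ℂ X X] [SMulCommClass ℂ X X] [StarModule ℂ X]
  [CompleteSpace X] [PartialOrder X] [StarOrderedRing X]

/-- A one-parameter C*-dynamical system: a group of *-automorphisms of `X`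
with norm-continuous orbit maps. -/
structure IsCStarDynSys (α : ℝ → X → X) : Prop where
  map_zero_time : ∀ x, α 0 x = x
  map_add_time : ∀ s t x, α (s + t) x = α s (α t x)
  map_add : ∀ t x y, α t (x + y) = α t x + α t y
  map_smulc : ∀ (t : ℝ) (c : ℂ) (x : X), α t (c • x) = c • α t x
  map_mul : ∀ t x y, α t (x * y) = α t x * α t y
  map_star : ∀ t x, α t (star x) = star (α t x)
  continuous_orbit : ∀ x, Continuous fun t => α t x

/-- Closed linear span. -/
def ClosedSpan (S : Set X) : Set X := closure ((Submodule.span ℂ S : Submodule ℂ X) : Set X)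

def MulSet2 (S T : Set X) : Set X := {z | ∃ s ∈ S, ∃ t ∈ T, z = s * t}

def MulSet3 (S T R : Set X) : Set X := {z | ∃ s ∈ S, ∃ t ∈ T, ∃ r ∈ R, z = s * t * r}

/-- Fourier transform of an integrable function. -/
def fourierT (f : ℝ → ℂ) (γ : ℝ) : ℂ := ∫ t : ℝ, f t * Complex.exp (-(Complex.I * γ * t))

/-- `α_f(x) = ∫ f(t) α_t(x) dt`. -/
def smear (α : ℝ → X → X) (f : ℝ → ℂ) (x : X) : X := ∫ t : ℝ, f t • α t x

/-- Arveson spectrum of an element. -/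
def elemSpec (α : ℝ → X → X) (x : X) : Set ℝ :=
  {γ | ∀ f : ℝ → ℂ, Integrable f → smear α f x = 0 → fourierT f γ = 0}

/-- Spectral subspace associated with a closed set `F ⊆ ℝ`. -/
def specC (α : ℝ → X → X) (F : Set ℝ) : Set X := {x | elemSpec α x ⊆ F}

/-- Spectral subspace of the subset `S` associated with an open set `U ⊆ ℝ`. -/
def specO (α : ℝ → X → X) (S : Set X) (U : Set ℝ) : Set X :=
  ClosedSpan {y | ∃ x ∈ S, ∃ f : ℝ → ℂ, Integrable f ∧
    IsCompact (tsupport (fourierT f)) ∧ tsupport (fourierT f) ⊆ U ∧ y = smear α f x}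

/-- The fixed point algebra `X^α`. -/
def fixedPts (α : ℝ → X → X) : Set X := {x | ∀ t, α t x = x}

/-- The Arveson spectrum of the action restricted to `S`. -/
def actSpec (α : ℝ → X → X) (S : Set X) : Set ℝ :=
  {γ : ℝ | ∀ ε > (0 : ℝ), S ∩ specC α (Icc (γ - ε) (γ + ε)) ≠ ({0} : Set X)}

def Invariant (α : ℝ → X → X) (S : Set X) : Prop := ∀ t : ℝ, ∀ x ∈ S, α t x ∈ S

def IsSubalgebra (B : Set X) : Prop :=
  (0 : X) ∈ B ∧ (∀ x ∈ B, ∀ y ∈ B, x + y ∈ B) ∧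
  (∀ c : ℂ, ∀ x ∈ B, c • x ∈ B) ∧ ∀ x ∈ B, ∀ y ∈ B, x * y ∈ B

def IsStarSubalgebra (B : Set X) : Prop := IsSubalgebra B ∧ ∀ x ∈ B, star x ∈ B

/-- `B` is a hereditary C*-subalgebra of the subset `S`. -/
def IsHereditaryIn (S B : Set X) : Prop :=
  B ⊆ S ∧ IsClosed B ∧ IsStarSubalgebra B ∧
  ∀ x ∈ S, ∀ b ∈ B, 0 ≤ x → x ≤ b → x ∈ B

/-- `K` is a norm-closed two-sided ideal of the subset `S`. -/
def IsClosedTwoSidedIdealIn (S K : Set X) : Prop :=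
  K ⊆ S ∧ IsClosed K ∧ (0 : X) ∈ K ∧ (∀ x ∈ K, ∀ y ∈ K, x + y ∈ K) ∧
  (∀ c : ℂ, ∀ x ∈ K, c • x ∈ K) ∧ ∀ s ∈ S, ∀ k ∈ K, s * k ∈ K ∧ k * s ∈ K

/-- `S` is `α`-simple: no nontrivial norm-closed `α`-invariant two-sided ideals. -/
def AlphaSimple (α : ℝ → X → X) (S : Set X) : Prop :=
  ∀ K : Set X, IsClosedTwoSidedIdealIn S K → Invariant α K → K = ({0} : Set X) ∨ K = S

/-- The strong Arveson spectrum of the action restricted to `B`. -/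
def strongSpec (α : ℝ → X → X) (B : Set X) : Set ℝ :=
  {γ : ℝ | ∀ ε > (0 : ℝ),
    ClosedSpan (MulSet3 (star '' (B ∩ specC α (Icc (γ - ε) (γ + ε)))) B
      (B ∩ specC α (Icc (γ - ε) (γ + ε)))) = B}

/-- The strong Connes spectrum of the action restricted to `S`. -/
def ConnesSpec (α : ℝ → X → X) (S : Set X) : Set ℝ :=
  ⋂ B ∈ {B : Set X | IsHereditaryIn S B ∧ B ≠ ({0} : Set X) ∧ Invariant α B},
    strongSpec α B

def IsMaximalClosedSubalgebra (B : Set X) : Prop :=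
  IsClosed B ∧ IsSubalgebra B ∧ B ≠ (univ : Set X) ∧
  ∀ W : Set X, IsClosed W → IsSubalgebra W → B ⊆ W → W = B ∨ W = univ

/-- The spectral Condition 4.3. -/
def Condition43 (α : ℝ → X → X) : Prop :=
  (∃ γ₀ : ℝ, 0 < γ₀ ∧ actSpec α (univ : Set X) = ({-γ₀, 0, γ₀} : Set ℝ) ∧
    IsClosedTwoSidedIdealIn (fixedPts α)
      (ClosedSpan (MulSet2 (specC α ({γ₀} : Set ℝ)) (star '' specC α ({γ₀} : Set ℝ)))) ∧
    ∀ K : Set X,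
      IsClosedTwoSidedIdealIn
        (ClosedSpan (MulSet2 (specC α ({γ₀} : Set ℝ)) (star '' specC α ({γ₀} : Set ℝ)))) K →
      K = ({0} : Set X) ∨
        K = ClosedSpan (MulSet2 (specC α ({γ₀} : Set ℝ)) (star '' specC α ({γ₀} : Set ℝ)))) ∨
  (∃ Y : Set X, IsClosedTwoSidedIdealIn (univ : Set X) Y ∧ Invariant α Y ∧ AlphaSimple α Y ∧
    specO α Y (Ioi (0 : ℝ)) = specO α (univ : Set X) (Ioi (0 : ℝ)) ∧
    actSpec α Y = ConnesSpec α Y ∧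
    closure (Y + specC α (Ici (0 : ℝ))) = (univ : Set X))

set_option linter.unusedSectionVars false

/-! ### Smooth compactly supported symbols and their kernels -/

/-- Smooth compactly supported complex functions on the line. -/
def IsTest (φ : ℝ → ℂ) : Prop := ContDiff ℝ (⊤ : ℕ∞) φ ∧ HasCompactSupport φ

/-- The inverse Fourier transform matching `fourierT`. -/
def ker (φ : ℝ → ℂ) (t : ℝ) : ℂ :=
  (2 * Real.pi : ℂ)⁻¹ * ∫ γ : ℝ, φ γ * Complex.exp (Complex.I * γ * t)

lemma IsTest.integrable {φ : ℝ → ℂ} (h : IsTest φ) : Integrable φ :=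
  h.1.continuous.integrable_of_hasCompactSupport h.2

lemma IsTest.mul {φ ψ : ℝ → ℂ} (h : IsTest φ) (h' : ContDiff ℝ (⊤ : ℕ∞) ψ) :
    IsTest (fun γ => φ γ * ψ γ) :=
  ⟨h.1.mul h', h.2.mul_right⟩

lemma IsTest.comp_scale {φ : ℝ → ℂ} (h : IsTest φ) (a : ℝ) {d : ℝ} (hd : 0 < d) :
    IsTest (fun γ => φ ((γ - a) / d)) := by
  refine ⟨h.1.comp ((contDiff_id.sub contDiff_const).div_const d), ?_⟩
  have := h.2.comp_homeomorph ((Homeomorph.addRight (-a)).trans (Homeomorph.mulRight₀ d⁻¹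
    (inv_ne_zero hd.ne')))
  convert! this using 2

lemma IsTest.exists_schwartz {φ : ℝ → ℂ} (h : IsTest φ) :
    ∃ k : SchwartzMap ℝ ℂ, (∀ t, k t = ker φ t) ∧ ∀ γ, fourierT k γ = φ γ := by
  have hpi : (0 : ℝ) < 2 * Real.pi := by positivity
  have h1 : IsTest (fun γ => φ ((γ - 0) / (2 * Real.pi)⁻¹)) := h.comp_scale 0 (by positivity)
  let s : SchwartzMap ℝ ℂ := h1.2.toSchwartzMap h1.1
  have hs : ∀ x, s x = φ (2 * Real.pi * x) := by
    intro x
    change φ ((x - 0) / (2 * Real.pi)⁻¹) = _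
    congr 1
    rw [sub_zero, div_inv_eq_mul, mul_comm]
  refine ⟨FourierTransformInv.fourierInv s, fun t => ?_, fun γ => ?_⟩
  · rw [SchwartzMap.fourierInv_coe, Real.fourierInv_eq']
    simp only [hs, smul_eq_mul]
    have e := Measure.integral_comp_mul_left
      (fun y : ℝ => φ y * Complex.exp (Complex.I * y * t)) (2 * Real.pi)
    rw [abs_of_pos (by positivity)] at e
    rw [ker]
    have e2 : ((2 * Real.pi : ℂ)⁻¹) = (((2 * Real.pi)⁻¹ : ℝ) : ℂ) := by push_cast; rfl
    rw [e2, ← Complex.real_smul, ← e]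
    congr 1; ext x
    rw [mul_comm]
    congr 2
    simp only [inner, Complex.ofReal_mul, Complex.ofReal_ofNat]
    simp
    ring
  · have hF : FourierTransform.fourier (FourierTransformInv.fourierInv s) = s :=
      FourierInvPair.fourier_fourierInv_eq s
    have : φ γ = s (γ / (2 * Real.pi)) := by rw [hs]; congr 1; field_simp
    rw [this]
    conv_rhs => rw [← hF]
    rw [SchwartzMap.fourier_coe, Real.fourier_real_eq_integral_exp_smul, fourierT]
    congr 1; ext x
    rw [smul_eq_mul, mul_comm]
    congr 2
    push_cast
    have : (Real.pi : ℂ) ≠ 0 := by exact_mod_cast Real.pi_ne_zero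
    field_simp

lemma IsTest.integrable_ker {φ : ℝ → ℂ} (h : IsTest φ) : Integrable (ker φ) := by
  obtain ⟨k, hk, -⟩ := h.exists_schwartz
  have : ker φ = k := by ext t; rw [hk]
  rw [this]; exact k.integrable

lemma IsTest.continuous_ker {φ : ℝ → ℂ} (h : IsTest φ) : Continuous (ker φ) := by
  obtain ⟨k, hk, -⟩ := h.exists_schwartz
  have : ker φ = k := by ext t; rw [hk]
  rw [this]; exact k.continuous

lemma IsTest.fourierT_ker {φ : ℝ → ℂ} (h : IsTest φ) (γ : ℝ) : fourierT (ker φ) γ = φ γ := by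
  obtain ⟨k, hk, hk'⟩ := h.exists_schwartz
  have : ker φ = k := by ext t; rw [hk]
  rw [this, hk']

lemma IsTest.exists_decay {φ : ℝ → ℂ} (h : IsTest φ) :
    ∃ C, 0 ≤ C ∧ ∀ t, ‖ker φ t‖ ≤ C * (1 + t ^ 2)⁻¹ := by
  obtain ⟨k, hk, -⟩ := h.exists_schwartz
  obtain ⟨C0, h0⟩ := k.decay 0 0
  obtain ⟨C2, h2⟩ := k.decay 2 0
  refine ⟨C0 + C2, ?_, fun t => ?_⟩
  · have a := h0.2 0
    have b := h2.2 0
    linarith [h0.1, h2.1]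
  · have a := h0.2 t
    have b := h2.2 t
    simp only [pow_zero, one_mul, norm_iteratedFDeriv_zero, Real.norm_eq_abs, sq_abs] at a b
    rw [← hk, ← div_eq_mul_inv, le_div_iff₀ (by positivity)]
    nlinarith

lemma IsTest.tendsto_translation {φ : ℝ → ℂ} (h : IsTest φ) :
    Tendsto (fun s => ∫ u, ‖ker φ (u - s) - ker φ u‖) (𝓝 0) (𝓝 0) := by
  obtain ⟨C, hC, hd⟩ := h.exists_decay
  have key : Tendsto (fun s => ∫ u, ‖ker φ (u - s) - ker φ u‖) (𝓝 0) (𝓝 (∫ u : ℝ, (0 : ℝ))) := by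
    refine tendsto_integral_filter_of_dominated_convergence
      (fun u : ℝ => 4 * C * (1 + u ^ 2)⁻¹) ?_ ?_ ?_ ?_
    · refine Eventually.of_forall fun s => ?_
      have := h.continuous_ker
      exact Continuous.aestronglyMeasurable (by fun_prop)
    · filter_upwards [Metric.closedBall_mem_nhds (0 : ℝ) one_pos] with s hs
      refine Eventually.of_forall fun u => ?_
      have hs' : s ^ 2 ≤ 1 := by
        rw [Metric.mem_closedBall, dist_zero_right] at hs
        rw [← sq_abs]; exact pow_le_one₀ (abs_nonneg s) hs
      have e1 : (1 + (u - s) ^ 2)⁻¹ ≤ 3 * (1 + u ^ 2)⁻¹ := by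
        rw [← div_eq_mul_inv, inv_eq_one_div, div_le_div_iff₀ (by positivity) (by positivity)]
        nlinarith [sq_nonneg (u - 2 * s)]
      have a := hd (u - s)
      have b := hd u
      rw [norm_norm]
      calc ‖ker φ (u - s) - ker φ u‖ ≤ ‖ker φ (u - s)‖ + ‖ker φ u‖ := norm_sub_le _ _
        _ ≤ C * (3 * (1 + u ^ 2)⁻¹) + C * (1 + u ^ 2)⁻¹ :=
          add_le_add (a.trans (mul_le_mul_of_nonneg_left e1 hC)) b
        _ = _ := by ring
    · exact (integrable_inv_one_add_sq).const_mul _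
    · refine Eventually.of_forall fun u => ?_
      have hc := h.continuous_ker
      have : Continuous fun s => ‖ker φ (u - s) - ker φ u‖ := by fun_prop
      simpa using this.tendsto 0
  simpa using key

lemma ker_scale (φ : ℝ → ℂ) (a : ℝ) {d : ℝ} (hd : 0 < d) (t : ℝ) :
    ker (fun γ => φ ((γ - a) / d)) t = d * Complex.exp (Complex.I * a * t) * ker φ (d * t) := by
  have e1 := integral_sub_right_eq_self (μ := (volume : Measure ℝ))
    (fun γ : ℝ => φ (γ / d) * Complex.exp (Complex.I * (γ + a : ℝ) * t)) a
  have e2 := Measure.integral_comp_div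
    (fun γ : ℝ => φ γ * Complex.exp (Complex.I * (d * γ + a : ℝ) * t)) d
  rw [abs_of_pos hd] at e2
  simp only [sub_add_cancel] at e1
  have e3 : (∫ γ : ℝ, φ (γ / d) * Complex.exp (Complex.I * (γ + a : ℝ) * t))
      = ∫ γ : ℝ, φ (γ / d) * Complex.exp (Complex.I * (d * (γ / d) + a : ℝ) * t) := by
    congr 1; ext x; congr 5; field_simp
  have e4 : (∫ γ : ℝ, φ γ * Complex.exp (Complex.I * (d * γ + a : ℝ) * t))
      = Complex.exp (Complex.I * a * t) * ∫ γ : ℝ, φ γ *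
        Complex.exp (Complex.I * γ * (d * t : ℝ)) := by
    rw [← integral_const_mul]
    congr 1; ext x
    rw [mul_left_comm, ← Complex.exp_add]
    congr 2; push_cast; ring
  simp only [ker]
  rw [e1, e3, e2, e4, Complex.real_smul]
  ring

/-- Convolving with a kernel multiplies symbols. -/
lemma IsTest.conv_ker {φ f : ℝ → ℂ} (h : IsTest φ) (hf : Integrable f) (t : ℝ) :
    ∫ s, f s * ker φ (t - s) = ker (fun γ => φ γ * fourierT f γ) t := by
  simp only [ker, fourierT]
  have hi : Integrable (Function.uncurry fun (s γ : ℝ) =>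
      f s * (φ γ * Complex.exp (Complex.I * γ * (t - s : ℝ)))) (volume.prod volume) := by
    have h0 := hf.mul_prod h.integrable
    refine (h0.bdd_mul (c := 1) (f := fun z : ℝ × ℝ =>
      Complex.exp (Complex.I * z.2 * (t - z.1 : ℝ))) ?_ ?_).congr ?_
    · exact Continuous.aestronglyMeasurable (by fun_prop)
    · refine Eventually.of_forall fun z => ?_
      rw [mul_assoc, ← Complex.ofReal_mul, mul_comm, Complex.norm_exp_ofReal_mul_I]
    · refine Eventually.of_forall fun z => ?_
      simp only [Function.uncurry]; ring
  have e := integral_integral_swap hi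
  calc _ = ∫ s, (2 * Real.pi : ℂ)⁻¹ * ∫ γ : ℝ, f s * (φ γ * Complex.exp (Complex.I * γ * (t - s : ℝ))) := by
        congr 1; ext s; rw [mul_left_comm, ← integral_const_mul (f s)]
    _ = _ := by
        rw [integral_const_mul, e]
        congr 2; ext γ
        rw [mul_assoc, ← integral_mul_const, ← integral_const_mul]
        congr 1; ext s
        have : Complex.exp (Complex.I * γ * (t - s : ℝ)) =
            Complex.exp (-(Complex.I * γ * s)) * Complex.exp (Complex.I * γ * t) := by
          rw [← Complex.exp_add]; congr 1; push_cast; ring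
        rw [this]; ring

lemma exists_test {K U : Set ℝ} (hK : IsCompact K) (hU : IsOpen U) (hKU : K ⊆ U) :
    ∃ φ, IsTest φ ∧ (∀ᶠ γ in 𝓝ˢ K, φ γ = 1) ∧ tsupport φ ⊆ U := by
  obtain ⟨V, hVo, hKV, hVU, hVc⟩ := exists_open_between_and_isCompact_closure hK hU hKU
  obtain ⟨f, h1, h0, -⟩ := exists_contMDiffMap_one_nhds_of_subset_interior
    (n := (⊤ : ℕ∞)) (modelWithCornersSelf ℝ ℝ) (s := K) (t := V) hK.isClosed
    (by rwa [hVo.interior_eq])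
  have hts : tsupport (fun γ => (f γ : ℂ)) ⊆ closure V := by
    refine closure_mono fun γ hγ => ?_
    by_contra hc
    exact hγ (by simp [h0 γ hc])
  refine ⟨fun γ => (f γ : ℂ), ⟨?_, ?_⟩, ?_, hts.trans hVU⟩
  · exact Complex.ofRealCLM.contDiff.comp f.contMDiff.contDiff
  · exact HasCompactSupport.of_support_subset_isCompact hVc
      ((subset_tsupport _).trans hts)
  · filter_upwards [h1] with γ hγ
    simp [hγ]

/-! ### Integrated action -/

section Smear

variable {α : ℝ → X → X}

/-- The action at time `t` as a star homomorphism. -/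
def IsCStarDynSys.hom (hα : IsCStarDynSys α) (t : ℝ) : X →⋆ₙₐ[ℂ] X where
  toFun := α t
  map_smul' c x := hα.map_smulc t c x
  map_zero' := by simpa using hα.map_smulc t 0 0
  map_add' x y := hα.map_add t x y
  map_mul' x y := hα.map_mul t x y
  map_star' x := hα.map_star t x

lemma IsCStarDynSys.norm_le (hα : IsCStarDynSys α) (t : ℝ) (x : X) : ‖α t x‖ ≤ ‖x‖ := by
  let _ : NonUnitalCStarAlgebra X := {}
  exact NonUnitalStarAlgHom.norm_apply_le (hα.hom t) x

lemma IsCStarDynSys.map_zero (hα : IsCStarDynSys α) (t : ℝ) : α t 0 = 0 := (hα.hom t).map_zero'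

lemma IsCStarDynSys.map_sub (hα : IsCStarDynSys α) (t : ℝ) (x y : X) :
    α t (x - y) = α t x - α t y := _root_.map_sub (hα.hom t) x y

/-- The action at time `t` as a continuous linear map. -/
def IsCStarDynSys.clm (hα : IsCStarDynSys α) (t : ℝ) : X →L[ℂ] X :=
  LinearMap.mkContinuous
    { toFun := α t, map_add' := hα.map_add t, map_smul' := hα.map_smulc t } 1
    fun x => by simpa using hα.norm_le t x

@[simp] lemma IsCStarDynSys.clm_apply (hα : IsCStarDynSys α) (t : ℝ) (x : X) :
    hα.clm t x = α t x := rfl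

lemma IsCStarDynSys.integrable (hα : IsCStarDynSys α) {f : ℝ → ℂ} (hf : Integrable f) (x : X) :
    Integrable fun t => f t • α t x :=
  hf.smul_bdd ‖x‖ (hα.continuous_orbit x).aestronglyMeasurable
    (Eventually.of_forall fun t => hα.norm_le t x)

lemma IsCStarDynSys.norm_smear_le (hα : IsCStarDynSys α) {f : ℝ → ℂ} (hf : Integrable f) (x : X) :
    ‖smear α f x‖ ≤ (∫ t, ‖f t‖) * ‖x‖ := by
  rw [smear, ← integral_mul_const]
  refine norm_integral_le_of_norm_le (hf.norm.mul_const _) (Eventually.of_forall fun t => ?_)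
  rw [norm_smul]
  exact mul_le_mul_of_nonneg_left (hα.norm_le t x) (norm_nonneg _)

/-- `smear` as a continuous linear map. -/
def IsCStarDynSys.smearL (hα : IsCStarDynSys α) {f : ℝ → ℂ} (hf : Integrable f) : X →L[ℂ] X :=
  LinearMap.mkContinuous
    { toFun := smear α f
      map_add' := fun x y => by
        simp only [smear, hα.map_add, smul_add]
        exact integral_add (hα.integrable hf x) (hα.integrable hf y)
      map_smul' := fun c x => by
        simp only [smear, hα.map_smulc, RingHom.id_apply]
        rw [← integral_smul]
        congr 1; ext t
        rw [smul_comm] } (∫ t, ‖f t‖) fun x => hα.norm_smear_le hf x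

@[simp] lemma IsCStarDynSys.smearL_apply (hα : IsCStarDynSys α) {f : ℝ → ℂ} (hf : Integrable f)
    (x : X) : hα.smearL hf x = smear α f x := rfl

lemma IsCStarDynSys.smear_sub_fun (hα : IsCStarDynSys α) {f g : ℝ → ℂ} (hf : Integrable f)
    (hg : Integrable g) (x : X) :
    smear α (fun t => f t - g t) x = smear α f x - smear α g x := by
  simp only [smear, sub_smul]
  exact integral_sub (hα.integrable hf x) (hα.integrable hg x)

lemma IsCStarDynSys.map_smear (hα : IsCStarDynSys α) {f : ℝ → ℂ} (hf : Integrable f)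
    (s : ℝ) (x : X) : α s (smear α f x) = ∫ t, f t • α (s + t) x := by
  have h := (hα.clm s).integral_comp_comm (hα.integrable hf x)
  simp only [hα.clm_apply] at h
  rw [smear, ← h]
  congr 1; ext t
  rw [hα.map_smulc, hα.map_add_time]

lemma IsCStarDynSys.map_smear_shift (hα : IsCStarDynSys α) {f : ℝ → ℂ} (hf : Integrable f)
    (s : ℝ) (x : X) : α s (smear α f x) = smear α (fun t => f (t - s)) x := by
  rw [hα.map_smear hf, smear, ← integral_add_right_eq_self (fun t => f (t - s) • α t x) s]
  simp [add_comm]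

lemma IsCStarDynSys.smear_smear (hα : IsCStarDynSys α) {f g : ℝ → ℂ} (hf : Integrable f)
    (hg : Integrable g) (x : X) :
    smear α f (smear α g x) = smear α (fun t => ∫ s, f s * g (t - s)) x := by
  have hi : Integrable (Function.uncurry fun (s t : ℝ) => (f s * g (t - s)) • α t x)
      (volume.prod volume) := by
    have h0 : Integrable (fun p : ℝ × ℝ => f p.2 * g (p.1 - p.2)) (volume.prod volume) :=
      Integrable.convolution_integrand (ContinuousLinearMap.mul ℂ ℂ) hf hg
    refine (h0.swap).smul_bdd (f := fun p : ℝ × ℝ => α p.2 x) ‖x‖ ?_ ?_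
    · exact ((hα.continuous_orbit x).comp continuous_snd).aestronglyMeasurable
    · exact Eventually.of_forall fun p => hα.norm_le _ _
  have e := integral_integral_swap hi
  calc smear α f (smear α g x) = ∫ s, ∫ t, (f s * g (t - s)) • α t x := by
        rw [smear]; congr 1; ext s
        rw [hα.map_smear_shift hg, smear, ← integral_smul]
        simp only [mul_smul]
    _ = _ := by
        rw [e, smear]
        congr 1; ext t
        exact integral_smul_const _ _

lemma IsCStarDynSys.smear_comm (hα : IsCStarDynSys α) {f g : ℝ → ℂ} (hf : Integrable f)
    (hg : Integrable g) (x : X) :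
    smear α f (smear α g x) = smear α g (smear α f x) := by
  rw [hα.smear_smear hf hg, hα.smear_smear hg hf]
  congr 1; ext t
  rw [← integral_sub_left_eq_self _ _ t]
  simp [mul_comm]

/-- The operator with symbol `φ` kills elements on which a multiple of the symbol vanishes. -/
lemma IsCStarDynSys.smear_ker_smear (hα : IsCStarDynSys α) {φ f : ℝ → ℂ} (hφ : IsTest φ)
    (hf : Integrable f) (x : X) :
    smear α (ker φ) (smear α f x) = smear α (ker fun γ => φ γ * fourierT f γ) x := by
  rw [hα.smear_comm hφ.integrable_ker hf, hα.smear_smear hf hφ.integrable_ker]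
  congr 1; ext t
  exact hφ.conv_ker hf t

lemma IsCStarDynSys.smear_ker_ker (hα : IsCStarDynSys α) {φ ψ : ℝ → ℂ} (hφ : IsTest φ)
    (hψ : IsTest ψ) (x : X) :
    smear α (ker φ) (smear α (ker ψ) x) = smear α (ker fun γ => φ γ * ψ γ) x := by
  rw [hα.smear_ker_smear hφ hψ.integrable_ker]
  simp only [hψ.fourierT_ker]

lemma ker_zero : ker (fun _ => 0) = fun _ => 0 := by
  ext t; simp [ker]

lemma smear_zero_fun (x : X) : smear α (fun _ => 0) x = 0 := by simp [smear]

lemma ker_sub {φ ψ : ℝ → ℂ} (hφ : IsTest φ) (hψ : IsTest ψ) :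
    ker (fun γ => φ γ - ψ γ) = fun t => ker φ t - ker ψ t := by
  ext t
  have hi : ∀ {χ : ℝ → ℂ}, IsTest χ →
      Integrable fun γ : ℝ => χ γ * Complex.exp (Complex.I * γ * t) := by
    intro χ h
    refine (h.integrable).mul_bdd (c := 1) ?_ ?_
    · exact Continuous.aestronglyMeasurable (by fun_prop)
    · refine Eventually.of_forall fun γ => ?_
      rw [mul_assoc, ← Complex.ofReal_mul, mul_comm, Complex.norm_exp_ofReal_mul_I]
  simp only [ker, sub_mul]
  rw [integral_sub (hi hφ) (hi hψ), mul_sub]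

lemma IsCStarDynSys.smear_ker_sub (hα : IsCStarDynSys α) {φ ψ : ℝ → ℂ} (hφ : IsTest φ)
    (hψ : IsTest ψ) (x : X) :
    smear α (ker fun γ => φ γ - ψ γ) x = smear α (ker φ) x - smear α (ker ψ) x := by
  rw [ker_sub hφ hψ, hα.smear_sub_fun hφ.integrable_ker hψ.integrable_ker]

end Smear

/-! ### Arveson spectrum of elements -/

section ElemSpec

variable {α : ℝ → X → X}

lemma IsTest.norm_translation_le {χ : ℝ → ℂ} (h : IsTest χ) (s : ℝ) :
    ∫ u, ‖ker χ (u - s) - ker χ u‖ ≤ 2 * ∫ u, ‖ker χ u‖ := by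
  have h1 := h.integrable_ker.comp_sub_right s
  calc ∫ u, ‖ker χ (u - s) - ker χ u‖ ≤ ∫ u, (‖ker χ (u - s)‖ + ‖ker χ u‖) :=
        integral_mono (h1.sub h.integrable_ker).norm (h1.norm.add h.integrable_ker.norm)
          fun u => norm_sub_le _ _
    _ = _ := by
        rw [integral_add h1.norm h.integrable_ker.norm,
          integral_sub_right_eq_self (fun u => ‖ker χ u‖) s]
        ring

lemma IsTest.measurable_translation {χ : ℝ → ℂ} (h : IsTest χ) :
    StronglyMeasurable fun s => ∫ u, ‖ker χ (u - s) - ker χ u‖ := by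
  have hc := h.continuous_ker
  refine StronglyMeasurable.integral_prod_right (f := fun s u => ‖ker χ (u - s) - ker χ u‖) ?_
  exact Continuous.stronglyMeasurable (by unfold Function.uncurry; fun_prop)

lemma norm_exp_I_mul (a t : ℝ) : ‖Complex.exp (Complex.I * a * t)‖ = 1 := by
  rw [mul_assoc, ← Complex.ofReal_mul, mul_comm, Complex.norm_exp_ofReal_mul_I]

/-- Elements whose spectrum lies near `γ₀` are approximate eigenvectors. -/
lemma IsCStarDynSys.approx_eigen (hα : IsCStarDynSys α) {χ : ℝ → ℂ} (hχ : IsTest χ) {γ₀ δ : ℝ}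
    (hδ : 0 < δ) {y : X} (hy : smear α (ker fun γ => χ ((γ - γ₀) / δ)) y = y) (t : ℝ) :
    ‖α t y - Complex.exp (-(Complex.I * γ₀ * t)) • y‖ ≤
      (∫ u, ‖ker χ (u - δ * t) - ker χ u‖) * ‖y‖ := by
  have hT := hχ.comp_scale γ₀ hδ
  have hi := hT.integrable_ker
  set k := ker fun γ => χ ((γ - γ₀) / δ) with hk
  have e1 : α t y = smear α (fun s => k (s - t)) y := by
    conv_lhs => rw [← hy]
    exact hα.map_smear_shift hi t y
  have e2 : Complex.exp (-(Complex.I * γ₀ * t)) • y =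
      smear α (fun s => Complex.exp (-(Complex.I * γ₀ * t)) * k s) y := by
    conv_lhs => rw [← hy]
    simp only [smear, mul_smul]
    rw [integral_smul]
  have h1 := hi.comp_sub_right t
  have h2 := hi.const_mul (Complex.exp (-(Complex.I * γ₀ * t)))
  rw [e1, e2, ← hα.smear_sub_fun h1 h2]
  refine (hα.norm_smear_le (h1.sub h2) y).trans (le_of_eq ?_)
  congr 1
  have e3 := Measure.integral_comp_mul_left (fun u => ‖ker χ (u - δ * t) - ker χ u‖) δ
  rw [abs_of_pos (by positivity)] at e3
  have e4 : ∀ s, ‖k (s - t) - Complex.exp (-(Complex.I * γ₀ * t)) * k s‖ =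
      δ * ‖ker χ (δ * s - δ * t) - ker χ (δ * s)‖ := by
    intro s
    rw [hk, ker_scale _ _ hδ, ker_scale _ _ hδ]
    have e5 : Complex.exp (Complex.I * γ₀ * (s - t : ℝ)) =
        Complex.exp (-(Complex.I * γ₀ * t)) * Complex.exp (Complex.I * γ₀ * s) := by
      rw [← Complex.exp_add]; congr 1; push_cast; ring
    have : (δ : ℂ) * Complex.exp (Complex.I * γ₀ * (s - t : ℝ)) * ker χ (δ * (s - t)) -
        Complex.exp (-(Complex.I * γ₀ * t)) * (δ * Complex.exp (Complex.I * γ₀ * s) *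
          ker χ (δ * s)) = δ * Complex.exp (Complex.I * γ₀ * (s - t : ℝ)) *
          (ker χ (δ * s - δ * t) - ker χ (δ * s)) := by
      rw [e5, ← mul_sub δ s t]; ring
    rw [this, norm_mul, norm_mul, norm_exp_I_mul, mul_one, Complex.norm_real, Real.norm_eq_abs,
      abs_of_pos hδ]
  simp only [Pi.sub_apply, e4]
  rw [integral_const_mul, e3, smul_eq_mul]
  field_simp

lemma exists_bump : ∃ χ : ℝ → ℂ, IsTest χ ∧ ∀ γ, |γ| ≤ 1 → χ γ = 1 := by
  obtain ⟨χ, h, h1, -⟩ := exists_test (isCompact_closedBall (0 : ℝ) 1) isOpen_univ (subset_univ _)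
  exact ⟨χ, h, fun γ hγ => h1.self_of_nhdsSet γ (by simpa using hγ)⟩

lemma IsCStarDynSys.exists_smear_eq_zero_of_notMem (hα : IsCStarDynSys α) {x : X} {γ₀ : ℝ}
    (h : γ₀ ∉ elemSpec α x) :
    ∃ δ > 0, ∀ φ, IsTest φ → tsupport φ ⊆ Metric.ball γ₀ δ → smear α (ker φ) x = 0 := by
  simp only [elemSpec, mem_ofPred_eq, not_forall] at h
  obtain ⟨g, hg, hgx, hg0⟩ := h
  obtain ⟨χ, hχ, hχ1⟩ := exists_bump
  have hlim : Tendsto (fun δ : ℝ => ∫ t, ‖g t‖ * ∫ u, ‖ker χ (u - δ * t) - ker χ u‖)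
      (𝓝[>] 0) (𝓝 (∫ t : ℝ, (0 : ℝ))) := by
    refine tendsto_integral_filter_of_dominated_convergence
      (fun t => ‖g t‖ * (2 * ∫ u, ‖ker χ u‖)) ?_ ?_ ?_ ?_
    · refine Eventually.of_forall fun δ => ?_
      refine hg.norm.aestronglyMeasurable.mul ?_
      exact (hχ.measurable_translation.comp_measurable
        (measurable_const_mul δ)).aestronglyMeasurable
    · refine Eventually.of_forall fun δ => Eventually.of_forall fun t => ?_
      rw [norm_mul, norm_norm, Real.norm_of_nonneg (integral_nonneg fun u => norm_nonneg _)]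
      exact mul_le_mul_of_nonneg_left (hχ.norm_translation_le _) (norm_nonneg _)
    · exact hg.norm.mul_const _
    · refine Eventually.of_forall fun t => ?_
      have : Tendsto (fun δ : ℝ => δ * t) (𝓝[>] 0) (𝓝 0) := by
        have : Continuous fun δ : ℝ => δ * t := by fun_prop
        simpa using (this.tendsto 0).mono_left nhdsWithin_le_nhds
      simpa using (hχ.tendsto_translation.comp this).const_mul ‖g t‖
  rw [integral_zero] at hlim
  have hpos : 0 < ‖fourierT g γ₀‖ := norm_pos_iff.mpr hg0
  obtain ⟨δ, hδlt, hδ⟩ := ((hlim.eventually (gt_mem_nhds hpos)).and self_mem_nhdsWithin).exists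
  refine ⟨δ, hδ, fun φ hφ hs => ?_⟩
  set y := smear α (ker φ) x with hy
  have hyy : smear α (ker fun γ => χ ((γ - γ₀) / δ)) y = y := by
    rw [hy, hα.smear_ker_ker (hχ.comp_scale γ₀ hδ) hφ]
    congr 2; ext γ
    by_cases hγ : γ ∈ tsupport φ
    · have := hs hγ
      rw [Metric.mem_ball, Real.dist_eq] at this
      rw [hχ1, one_mul]
      rw [abs_div, abs_of_pos (show (0 : ℝ) < δ from hδ), div_le_one hδ]
      exact this.le
    · rw [image_eq_zero_of_notMem_tsupport hγ, mul_zero]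
  have hgy : smear α g y = 0 := by
    rw [hy, hα.smear_comm hg hφ.integrable_ker, hgx]
    exact (hα.smearL hφ.integrable_ker).map_zero
  have hie : Integrable fun t : ℝ => g t * Complex.exp (-(Complex.I * γ₀ * t)) := by
    refine hg.mul_bdd (c := 1) (Continuous.aestronglyMeasurable (by fun_prop))
      (Eventually.of_forall fun t => ?_)
    rw [← neg_mul, ← mul_neg, ← Complex.ofReal_neg, norm_exp_I_mul]
  have e : fourierT g γ₀ • y = - ∫ t, g t • (α t y - Complex.exp (-(Complex.I * γ₀ * t)) • y) := by
    simp only [smul_sub, smul_smul]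
    rw [integral_sub (hα.integrable hg y) (hie.smul_const y), integral_smul_const,
      ← smear, hgy, fourierT]
    simp
  have hle : ‖fourierT g γ₀‖ * ‖y‖ ≤
      (∫ t, ‖g t‖ * ∫ u, ‖ker χ (u - δ * t) - ker χ u‖) * ‖y‖ := by
    rw [← norm_smul, e, norm_neg, ← integral_mul_const]
    refine norm_integral_le_of_norm_le ?_ (Eventually.of_forall fun t => ?_)
    · refine Integrable.mul_const ?_ _
      refine hg.norm.mul_bdd (c := 2 * ∫ u, ‖ker χ u‖) ?_ ?_
      · exact (hχ.measurable_translation.comp_measurable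
          (measurable_const_mul δ)).aestronglyMeasurable
      · refine Eventually.of_forall fun t => ?_
        rw [Real.norm_of_nonneg (integral_nonneg fun u => norm_nonneg _)]
        exact hχ.norm_translation_le _
    · rw [norm_smul, mul_assoc ‖g t‖]
      exact mul_le_mul_of_nonneg_left (hα.approx_eigen hχ hδ hyy t) (norm_nonneg (g t))
  by_contra hne
  have : 0 < ‖y‖ := norm_pos_iff.mpr fun h0 => hne (hy ▸ h0)
  nlinarith

lemma IsCStarDynSys.elemSpec_smear_subset (hα : IsCStarDynSys α) {f : ℝ → ℂ} (hf : Integrable f)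
    (x : X) : elemSpec α (smear α f x) ⊆ elemSpec α x := by
  intro γ hγ g hg hgx
  refine hγ g hg ?_
  rw [hα.smear_comm hg hf, hgx]
  exact (hα.smearL hf).map_zero

lemma notMem_of_smear_ker {φ : ℝ → ℂ} (hφ : IsTest φ)
    {x : X} {γ : ℝ} (hγ : φ γ ≠ 0) (h : smear α (ker φ) x = 0) : γ ∉ elemSpec α x := by
  intro hm
  exact hγ (by rw [← hφ.fourierT_ker]; exact hm _ hφ.integrable_ker h)

lemma exists_test_at {γ : ℝ} {U : Set ℝ} (hU : IsOpen U) (hγ : γ ∈ U) :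
    ∃ φ, IsTest φ ∧ φ γ = 1 ∧ tsupport φ ⊆ U := by
  obtain ⟨φ, h, h1, h2⟩ := exists_test (isCompact_singleton (x := γ)) hU (by simpa using hγ)
  exact ⟨φ, h, h1.self_of_nhdsSet γ rfl, h2⟩

lemma IsCStarDynSys.elemSpec_smear_subset_tsupport (hα : IsCStarDynSys α) {f : ℝ → ℂ}
    (hf : Integrable f) (x : X) : elemSpec α (smear α f x) ⊆ tsupport (fourierT f) := by
  intro γ hγ
  by_contra hc
  obtain ⟨φ, hφ, h1, hs⟩ := exists_test_at (isClosed_tsupport (fourierT f)).isOpen_compl hc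
  refine notMem_of_smear_ker hφ (by simp [h1]) ?_ hγ
  rw [hα.smear_ker_smear hφ hf]
  have : (fun γ => φ γ * fourierT f γ) = fun _ => 0 := by
    ext η
    by_cases hη : η ∈ tsupport φ
    · rw [image_eq_zero_of_notMem_tsupport (hs hη), mul_zero]
    · rw [image_eq_zero_of_notMem_tsupport hη, zero_mul]
  rw [this, ker_zero, smear_zero_fun]

lemma IsCStarDynSys.tendsto_smear_ker (hα : IsCStarDynSys α) {φ : ℝ → ℂ} (hφ : IsTest φ)
    (h0 : φ 0 = 1) (x : X) :
    Tendsto (fun r : ℝ => smear α (ker fun γ => φ ((γ - 0) / r)) x) atTop (𝓝 x) := by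
  have e : ∀ r : ℝ, 0 < r → smear α (ker fun γ => φ ((γ - 0) / r)) x =
      ∫ u, ker φ u • α (r⁻¹ * u) x := by
    intro r hr
    have e3 := Measure.integral_comp_mul_left (fun u => ker φ u • α (r⁻¹ * u) x) r
    rw [abs_of_pos (by positivity)] at e3
    rw [smear]
    have : ∀ t, ker (fun γ => φ ((γ - 0) / r)) t • α t x =
        r • (ker φ (r * t) • α (r⁻¹ * (r * t)) x) := by
      intro t
      rw [ker_scale _ _ hr, inv_mul_cancel_left₀ hr.ne']
      simp only [Complex.ofReal_zero, mul_zero, zero_mul, Complex.exp_zero, mul_one]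
      rw [mul_smul, Complex.coe_smul]
    simp only [this]
    rw [integral_smul, e3, smul_smul, mul_inv_cancel₀ hr.ne', one_smul]
  have hlim : Tendsto (fun r : ℝ => ∫ u, ker φ u • α (r⁻¹ * u) x) atTop
      (𝓝 (∫ u, ker φ u • x)) := by
    refine tendsto_integral_filter_of_dominated_convergence (fun u => ‖ker φ u‖ * ‖x‖) ?_ ?_ ?_ ?_
    · refine Eventually.of_forall fun r => ?_
      refine hφ.integrable_ker.aestronglyMeasurable.smul ?_
      exact ((hα.continuous_orbit x).comp (continuous_const_mul _)).aestronglyMeasurable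
    · refine Eventually.of_forall fun r => Eventually.of_forall fun u => ?_
      rw [norm_smul]
      exact mul_le_mul_of_nonneg_left (hα.norm_le _ _) (norm_nonneg _)
    · exact hφ.integrable_ker.norm.mul_const _
    · refine Eventually.of_forall fun u => ?_
      have h1 : Tendsto (fun r : ℝ => r⁻¹ * u) atTop (𝓝 0) := by
        simpa using tendsto_inv_atTop_zero.mul_const u
      have h2 := ((hα.continuous_orbit x).tendsto 0).comp h1
      rw [hα.map_zero_time] at h2
      exact h2.const_smul _
  have e1 : ∫ u, ker φ u • x = x := by
    rw [integral_smul_const]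
    have := hφ.fourierT_ker 0
    rw [h0, fourierT] at this
    simp only [Complex.ofReal_zero, mul_zero, zero_mul, neg_zero, Complex.exp_zero,
      mul_one] at this
    rw [this, one_smul]
  rw [e1] at hlim
  refine hlim.congr' ?_
  filter_upwards [eventually_gt_atTop 0] with r hr
  exact (e r hr).symm

lemma IsCStarDynSys.eq_zero_of_smear_ker (hα : IsCStarDynSys α) {x : X}
    (h : ∀ φ, IsTest φ → smear α (ker φ) x = 0) : x = 0 := by
  obtain ⟨χ, hχ, hχ1⟩ := exists_bump
  have h1 := hα.tendsto_smear_ker hχ (hχ1 0 (by simp)) x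
  refine tendsto_nhds_unique h1 ?_
  refine tendsto_const_nhds.congr' ?_
  filter_upwards [eventually_gt_atTop 0] with r hr
  exact (h _ (hχ.comp_scale 0 hr)).symm

lemma IsTest.one_sub_mul {φ ψ : ℝ → ℂ} (hφ : IsTest φ) (hψ : IsTest ψ) :
    IsTest fun γ => φ γ * (1 - ψ γ) := hφ.mul (contDiff_const.sub hψ.1)

lemma IsCStarDynSys.eq_zero_of_elemSpec_eq_empty (hα : IsCStarDynSys α) {x : X}
    (h : elemSpec α x = ∅) : x = 0 := by
  refine hα.eq_zero_of_smear_ker fun φ hφ => ?_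
  obtain ⟨U, -, hsU, hU⟩ : ∃ U : Set ℝ, IsOpen U ∧ tsupport φ ⊆ U ∧
      ∀ ψ, IsTest ψ → tsupport ψ ⊆ U → smear α (ker ψ) x = 0 := by
    have hc : IsCompact (tsupport φ) := hφ.2
    refine IsCompact.induction_on hc (p := fun s => ∃ U : Set ℝ, IsOpen U ∧ s ⊆ U ∧
      ∀ ψ, IsTest ψ → tsupport ψ ⊆ U → smear α (ker ψ) x = 0) ?_ ?_ ?_ ?_
    · refine ⟨∅, isOpen_empty, subset_rfl, fun ψ _ hs => ?_⟩
      have : ψ = fun _ => 0 := by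
        ext γ; exact image_eq_zero_of_notMem_tsupport fun hγ => hs hγ
      rw [this, ker_zero, smear_zero_fun]
    · rintro s t hst ⟨U, ho, hs, hU⟩
      exact ⟨U, ho, hst.trans hs, hU⟩
    · rintro s t ⟨U, hUo, hsU, hU⟩ ⟨V, hVo, hsV, hV⟩
      refine ⟨U ∪ V, hUo.union hVo, union_subset_union hsU hsV, fun ψ hψ hs => ?_⟩
      have hK : IsCompact (tsupport ψ \ V) := hψ.2.diff hVo
      obtain ⟨η, hη, h1, hsη⟩ := exists_test hK hUo (fun γ hγ => (hs hγ.1).resolve_right hγ.2)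
      have a1 : smear α (ker fun γ => ψ γ * η γ) x = 0 :=
        hU _ (hψ.mul hη.1) ((closure_mono (Function.support_mul_subset_right _ _)).trans hsη)
      have a2 : smear α (ker fun γ => ψ γ * (1 - η γ)) x = 0 := by
        refine hV _ (hψ.one_sub_mul hη) fun γ hγ => ?_
        by_contra hγV
        have hγψ : γ ∈ tsupport ψ :=
          closure_mono (Function.support_mul_subset_left _ _) hγ
        have h2 : ∀ᶠ z in 𝓝 γ, η z = 1 := (eventually_nhdsSet_iff_forall.mp h1) γ ⟨hγψ, hγV⟩
        refine (notMem_tsupport_iff_eventuallyEq.mpr ?_) hγ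
        filter_upwards [h2] with z hz
        simp [hz]
      have := hα.smear_ker_sub hψ (hψ.one_sub_mul hη) x
      rw [a2, sub_zero] at this
      rw [← this, ← a1]
      congr 2; ext γ; ring
    · intro γ hγ
      obtain ⟨δ, hδ, hv⟩ := hα.exists_smear_eq_zero_of_notMem (x := x) (γ₀ := γ) (by simp [h])
      exact ⟨Metric.ball γ δ, mem_nhdsWithin_of_mem_nhds (Metric.ball_mem_nhds _ hδ),
        Metric.ball γ δ, Metric.isOpen_ball, subset_rfl, hv⟩
  exact hU φ hφ hsU

/-- Vanishing of the integrated action when the symbol vanishes near the spectrum. -/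
lemma IsCStarDynSys.smear_eq_zero (hα : IsCStarDynSys α) {f : ℝ → ℂ} (hf : Integrable f) {x : X}
    (h : Disjoint (tsupport (fourierT f)) (elemSpec α x)) : smear α f x = 0 := by
  refine hα.eq_zero_of_elemSpec_eq_empty ?_
  refine subset_empty_iff.mp fun γ hγ => ?_
  exact h.le_bot ⟨hα.elemSpec_smear_subset_tsupport hf x hγ, hα.elemSpec_smear_subset hf x hγ⟩

lemma IsTest.fourierT_ker_eq {φ : ℝ → ℂ} (h : IsTest φ) : fourierT (ker φ) = φ :=
  funext h.fourierT_ker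

lemma IsCStarDynSys.smear_ker_eq_zero (hα : IsCStarDynSys α) {φ : ℝ → ℂ} (hφ : IsTest φ) {x : X}
    (h : Disjoint (tsupport φ) (elemSpec α x)) : smear α (ker φ) x = 0 :=
  hα.smear_eq_zero hφ.integrable_ker (by rwa [hφ.fourierT_ker_eq])

lemma IsCStarDynSys.elemSpec_smear_ker (hα : IsCStarDynSys α) {φ : ℝ → ℂ} (hφ : IsTest φ) (x : X) :
    elemSpec α (smear α (ker φ) x) ⊆ tsupport φ := by
  have := hα.elemSpec_smear_subset_tsupport hφ.integrable_ker x
  rwa [hφ.fourierT_ker_eq] at this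

lemma IsCStarDynSys.smear_ker_eq_self (hα : IsCStarDynSys α) {φ : ℝ → ℂ} (hφ : IsTest φ) {x : X}
    (h : ∀ᶠ γ in 𝓝ˢ (elemSpec α x), φ γ = 1) : smear α (ker φ) x = x := by
  rw [← sub_eq_zero]
  refine hα.eq_zero_of_smear_ker fun ψ hψ => ?_
  have e : smear α (ker ψ) (smear α (ker φ) x - x) =
      - smear α (ker fun γ => ψ γ * (1 - φ γ)) x := by
    have h1 := (hα.smearL hψ.integrable_ker).map_sub (smear α (ker φ) x) x
    simp only [hα.smearL_apply] at h1
    rw [h1, hα.smear_ker_ker hψ hφ]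
    have := hα.smear_ker_sub hψ (hψ.mul hφ.1) x
    rw [← neg_sub, ← this]
    congr 3; ext γ; ring
  rw [e, hα.smear_ker_eq_zero (hψ.one_sub_mul hφ), neg_zero]
  rw [disjoint_left]
  intro γ hγ hγx
  have h2 : ∀ᶠ z in 𝓝 γ, φ z = 1 := (eventually_nhdsSet_iff_forall.mp h) γ hγx
  refine (notMem_tsupport_iff_eventuallyEq.mpr ?_) hγ
  filter_upwards [h2] with z hz
  simp [hz]

end ElemSpec

/-! ### Spectral subspaces -/

section SpecSubspace

variable {α : ℝ → X → X}

lemma IsCStarDynSys.mem_specC_iff (hα : IsCStarDynSys α) {F : Set ℝ} (hF : IsClosed F) {x : X} :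
    x ∈ specC α F ↔ ∀ φ, IsTest φ → Disjoint (tsupport φ) F → smear α (ker φ) x = 0 := by
  constructor
  · intro hx φ hφ hd
    exact hα.smear_ker_eq_zero hφ (hd.mono_right hx)
  · intro h γ hγ
    by_contra hc
    obtain ⟨φ, hφ, h1, hs⟩ := exists_test_at hF.isOpen_compl hc
    exact notMem_of_smear_ker hφ (by simp [h1])
      (h φ hφ (disjoint_left.mpr fun η hη => hs hη)) hγ

lemma specC_mono {F G : Set ℝ} (h : F ⊆ G) : specC α F ⊆ specC α G := fun _ hx => hx.trans h

/-- A closed spectral subspace as a submodule. -/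
def IsCStarDynSys.specM (hα : IsCStarDynSys α) {F : Set ℝ} (hF : IsClosed F) : Submodule ℂ X where
  carrier := specC α F
  zero_mem' := (hα.mem_specC_iff hF).mpr fun φ hφ _ => (hα.smearL hφ.integrable_ker).map_zero
  add_mem' := fun {x y} hx hy => (hα.mem_specC_iff hF).mpr fun φ hφ hd => by
    have := (hα.smearL hφ.integrable_ker).map_add x y
    simp only [hα.smearL_apply] at this
    rw [this, (hα.mem_specC_iff hF).mp hx φ hφ hd, (hα.mem_specC_iff hF).mp hy φ hφ hd, add_zero]
  smul_mem' := fun c x hx => (hα.mem_specC_iff hF).mpr fun φ hφ hd => by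
    have := (hα.smearL hφ.integrable_ker).map_smul c x
    simp only [hα.smearL_apply] at this
    rw [this, (hα.mem_specC_iff hF).mp hx φ hφ hd, smul_zero]

lemma IsCStarDynSys.isClosed_specC (hα : IsCStarDynSys α) {F : Set ℝ} (hF : IsClosed F) :
    IsClosed (specC α F) := by
  have : specC α F = ⋂ (φ : ℝ → ℂ) (hφ : IsTest φ) (_ : Disjoint (tsupport φ) F),
      {x | hα.smearL hφ.integrable_ker x = 0} := by
    ext x
    rw [hα.mem_specC_iff hF]
    simp only [mem_iInter, hα.smearL_apply, mem_ofPred_eq]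
  rw [this]
  exact isClosed_iInter fun φ => isClosed_iInter fun hφ => isClosed_iInter fun _ =>
    isClosed_singleton.preimage (hα.smearL hφ.integrable_ker).continuous

lemma IsCStarDynSys.smear_star (hα : IsCStarDynSys α) (f : ℝ → ℂ) (x : X) :
    smear α f (star x) = star (smear α (fun t => star (f t)) x) := by
  have := (starL' ℝ : X ≃L[ℝ] X).integral_comp_comm (fun t => star (f t) • α t x) (μ := volume)
  simp only [starL'_apply, star_smul, star_star, ← hα.map_star] at this
  exact this

lemma fourierT_star (f : ℝ → ℂ) (γ : ℝ) :
    fourierT (fun t => star (f t)) γ = star (fourierT f (-γ)) := by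
  rw [fourierT, fourierT]
  have : star (∫ t : ℝ, f t * Complex.exp (-(Complex.I * ((-γ : ℝ) : ℂ) * t))) =
      ∫ t : ℝ, star (f t * Complex.exp (-(Complex.I * ((-γ : ℝ) : ℂ) * t))) := integral_conj.symm
  rw [this]
  congr 1; ext t
  rw [star_mul', Complex.star_def, ← Complex.exp_conj]
  simp

lemma IsCStarDynSys.elemSpec_star (hα : IsCStarDynSys α) {x : X} {γ : ℝ}
    (h : γ ∈ elemSpec α (star x)) : -γ ∈ elemSpec α x := by
  intro f hf hfx
  have h1 : Integrable fun t => star (f t) :=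
    (LinearIsometryEquiv.integrable_comp_iff Complex.conjLIE).mpr hf
  have h2 := h _ h1 (by
    rw [hα.smear_star]
    simp only [star_star]
    change star (smear α f x) = 0
    rw [hfx, star_zero])
  rwa [fourierT_star, star_eq_zero] at h2

lemma IsCStarDynSys.star_mem_specC (hα : IsCStarDynSys α) {F : Set ℝ} {x : X}
    (hx : x ∈ specC α F) : star x ∈ specC α (-F) := fun _ hγ => hx (hα.elemSpec_star hγ)

lemma IsCStarDynSys.star_mem_specC' (hα : IsCStarDynSys α) {F G : Set ℝ} (h : ∀ γ ∈ F, -γ ∈ G)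
    {x : X} (hx : x ∈ specC α F) : star x ∈ specC α G :=
  specC_mono (fun γ hγ => by simpa using h _ hγ) (hα.star_mem_specC hx)

lemma IsCStarDynSys.reverse (hα : IsCStarDynSys α) : IsCStarDynSys fun t => α (-t) where
  map_zero_time x := by simpa using hα.map_zero_time x
  map_add_time s t x := by rw [neg_add]; exact hα.map_add_time _ _ x
  map_add t := hα.map_add _
  map_smulc t := hα.map_smulc _
  map_mul t := hα.map_mul _
  map_star t := hα.map_star _
  continuous_orbit x := (hα.continuous_orbit x).comp continuous_neg

lemma smear_reverse (f : ℝ → ℂ) (x : X) :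
    smear (fun t => α (-t)) f x = smear α (fun t => f (-t)) x := by
  rw [smear, smear, ← integral_neg_eq_self]
  simp

lemma fourierT_comp_neg (f : ℝ → ℂ) (γ : ℝ) :
    fourierT (fun t => f (-t)) γ = fourierT f (-γ) := by
  rw [fourierT, fourierT, ← integral_neg_eq_self]
  simp

lemma elemSpec_reverse (x : X) : elemSpec (fun t => α (-t)) x = -elemSpec α x := by
  have key : ∀ (β : ℝ → X → X) γ, γ ∈ elemSpec β x → -γ ∈ elemSpec (fun t => β (-t)) x := by
    intro β γ h f hf hfx
    rw [← fourierT_comp_neg]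
    exact h _ hf.comp_neg (by rw [← smear_reverse]; exact hfx)
  ext γ
  constructor
  · intro h
    have := key _ _ h
    simpa using this
  · intro h
    have := key _ _ h
    simpa using this

lemma specC_reverse (F : Set ℝ) : specC (fun t => α (-t)) F = specC α (-F) := by
  ext x
  simp only [specC, mem_ofPred_eq, elemSpec_reverse]
  exact Set.neg_subset

/-- Spectral subspaces multiply according to addition of spectra. -/
lemma IsCStarDynSys.mul_mem_specC (hα : IsCStarDynSys α) {F₁ F₂ G : Set ℝ} (h₂ : IsClosed F₂)
    (hG : IsClosed G) (hsum : ∀ a ∈ F₁, ∀ b ∈ F₂, a + b ∈ G) {x y : X}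
    (hx : x ∈ specC α F₁) (hy : y ∈ specC α F₂) : x * y ∈ specC α G := by
  obtain ⟨ψ, hψ, hψ1⟩ := exists_bump
  have hlim := (hα.tendsto_smear_ker hψ (hψ1 0 (by simp)) y).const_mul x
  refine (hα.isClosed_specC hG).mem_of_tendsto hlim ?_
  filter_upwards [eventually_gt_atTop 0] with r hr
  have hψr := hψ.comp_scale 0 hr
  set ψ' := fun γ => ψ ((γ - 0) / r) with hψ'
  set z := smear α (ker ψ') y with hz
  set K := tsupport ψ' ∩ F₂ with hK
  have hzK : elemSpec α z ⊆ K := subset_inter (hα.elemSpec_smear_ker hψr y)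
    ((hα.elemSpec_smear_subset hψr.integrable_ker y).trans hy)
  have hKc : IsCompact K := hψr.2.inter_right h₂
  intro γ₀ hγ₀
  by_contra hγG
  obtain ⟨ε, hε, hball⟩ := Metric.isOpen_iff.mp hG.isOpen_compl γ₀ hγG
  set δ := ε / 3 with hδ
  have hδ0 : 0 < δ := by positivity
  obtain ⟨η, hη, hη1, hηs⟩ := exists_test hKc (Metric.isOpen_thickening (δ := δ))
    (Metric.self_subset_thickening hδ0 K)
  obtain ⟨χ, hχ, hχ1, hχs⟩ := exists_test_at (Metric.isOpen_ball (x := γ₀) (ε := δ))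
    (Metric.mem_ball_self hδ0)
  have hzz : smear α (ker η) z = z :=
    hα.smear_ker_eq_self hη (hη1.filter_mono (nhdsSet_mono hzK))
  refine notMem_of_smear_ker hχ (by simp [hχ1]) ?_ hγ₀
  have hi : Integrable (Function.uncurry fun (s t : ℝ) =>
      (ker χ s * ker η (t - s)) • (α s x * α t z)) (volume.prod volume) := by
    have h0 : Integrable (fun p : ℝ × ℝ => ker χ p.2 * ker η (p.1 - p.2)) (volume.prod volume) :=
      Integrable.convolution_integrand (ContinuousLinearMap.mul ℂ ℂ) hχ.integrable_ker
        hη.integrable_ker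
    refine (h0.swap).smul_bdd (f := fun p : ℝ × ℝ => α p.1 x * α p.2 z) (‖x‖ * ‖z‖) ?_ ?_
    · exact (((hα.continuous_orbit x).comp continuous_fst).mul
        ((hα.continuous_orbit z).comp continuous_snd)).aestronglyMeasurable
    · exact Eventually.of_forall fun p => (norm_mul_le _ _).trans
        (mul_le_mul (hα.norm_le _ _) (hα.norm_le _ _) (norm_nonneg _) (norm_nonneg _))
  have hbd : ∃ C, ∀ t, ‖ker η t‖ ≤ C := by
    refine ⟨(2 * Real.pi)⁻¹ * ∫ γ, ‖η γ‖, fun t => ?_⟩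
    rw [ker, norm_mul]
    refine mul_le_mul (by simp [abs_of_pos Real.pi_pos]) ?_ (norm_nonneg _) (by positivity)
    refine (norm_integral_le_integral_norm _).trans (le_of_eq ?_)
    congr 1; ext γ
    rw [norm_mul, norm_exp_I_mul, mul_one]
  obtain ⟨C, hC⟩ := hbd
  have hh : ∀ t, Integrable fun s => ker χ s * ker η (t - s) := fun t =>
    hχ.integrable_ker.mul_bdd (c := C)
      (hη.continuous_ker.comp (continuous_const.sub continuous_id)).aestronglyMeasurable
      (Eventually.of_forall fun s => hC _)
  have hF : ∀ t γ, fourierT (fun s => ker χ s * ker η (t - s)) γ =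
      ker (fun ζ => η ζ * χ (γ + ζ)) t := by
    intro t γ
    have hie : Integrable fun s : ℝ => ker χ s * Complex.exp (-(Complex.I * γ * s)) := by
      refine hχ.integrable_ker.mul_bdd (c := 1) (Continuous.aestronglyMeasurable (by fun_prop))
        (Eventually.of_forall fun t => ?_)
      rw [← neg_mul, ← mul_neg, ← Complex.ofReal_neg, norm_exp_I_mul]
    have h1 := hη.conv_ker hie t
    have h2 : ∀ ζ, fourierT (fun s : ℝ => ker χ s * Complex.exp (-(Complex.I * γ * s))) ζ =
        χ (γ + ζ) := by
      intro ζ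
      rw [← hχ.fourierT_ker, fourierT, fourierT]
      congr 1; ext s
      rw [mul_assoc, ← Complex.exp_add]
      congr 2; push_cast; ring
    simp only [h2] at h1
    rw [← h1, fourierT]
    congr 1; ext s; ring
  have hzero : ∀ t, smear α (fun s => ker χ s * ker η (t - s)) x = 0 := by
    intro t
    refine hα.smear_eq_zero (hh t) (disjoint_left.mpr fun γ hγ hγx => ?_)
    obtain ⟨γ', hγ', hne⟩ := mem_closure_iff_nhds.mp hγ _ (Metric.ball_mem_nhds γ hδ0)
    rw [Function.mem_support, hF] at hne
    have : ∃ ζ, η ζ * χ (γ' + ζ) ≠ 0 := by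
      by_contra hcon
      push Not at hcon
      simp [ker, hcon] at hne
    obtain ⟨ζ, hζ⟩ := this
    obtain ⟨k, hkK, hkζ⟩ := Metric.mem_thickening_iff.mp
      (hηs (subset_tsupport _ (left_ne_zero_of_mul hζ)))
    have hc := hχs (subset_tsupport _ (right_ne_zero_of_mul hζ))
    refine hball (?_ : γ + k ∈ Metric.ball γ₀ ε) (hsum γ (hx hγx) k hkK.2)
    rw [Metric.mem_ball, Real.dist_eq, abs_lt] at *
    constructor <;> linarith [hγ'.1, hγ'.2, hc.1, hc.2, hkζ.1, hkζ.2]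
  calc smear α (ker χ) (x * z) = ∫ s, ∫ t, (ker χ s * ker η (t - s)) • (α s x * α t z) := by
        rw [smear]; congr 1; ext s
        rw [hα.map_mul]
        conv_lhs => rw [← hzz]
        rw [hα.map_smear_shift hη.integrable_ker, smear]
        have h1 := (ContinuousLinearMap.mul ℂ X (α s x)).integral_comp_comm
          (hα.integrable (hη.integrable_ker.comp_sub_right s) z)
        simp only [ContinuousLinearMap.mul_apply'] at h1
        rw [← h1, ← integral_smul]
        congr 1; ext t
        rw [mul_smul_comm, mul_smul]
    _ = ∫ t, smear α (fun s => ker χ s * ker η (t - s)) x * α t z := by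
        rw [integral_integral_swap hi]
        congr 1; ext t
        have h1 := ((ContinuousLinearMap.mul ℂ X).flip (α t z)).integral_comp_comm
          (hα.integrable (hh t) x)
        simp only [ContinuousLinearMap.flip_apply, ContinuousLinearMap.mul_apply'] at h1
        rw [smear, ← h1]
        congr 1; ext s
        rw [smul_mul_assoc]
    _ = 0 := by simp [hzero]

end SpecSubspace

/-! ### Closed spans and approximate units -/

section ApproxUnit

/-- The closed linear span as a submodule. -/
def cspan (S : Set X) : Submodule ℂ X := (Submodule.span ℂ S).topologicalClosure

lemma coe_cspan (S : Set X) : (cspan S : Set X) = ClosedSpan S := rfl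

lemma isClosed_cspan (S : Set X) : IsClosed (cspan S : Set X) :=
  (Submodule.span ℂ S).isClosed_topologicalClosure

lemma subset_cspan (S : Set X) : S ⊆ cspan S :=
  fun _ hx => (Submodule.span ℂ S).le_topologicalClosure (Submodule.subset_span hx)

lemma cspan_le {S : Set X} {M : Submodule ℂ X} (hM : IsClosed (M : Set X)) (h : S ⊆ M) :
    cspan S ≤ M :=
  (Submodule.span ℂ S).topologicalClosure_minimal (Submodule.span_le.mpr h) hM

lemma cspan_mono {S T : Set X} (h : S ⊆ T) : cspan S ≤ cspan T :=
  cspan_le (isClosed_cspan T) (h.trans (subset_cspan T))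

lemma map_mem_of_mem_cspan {S : Set X} {M : Submodule ℂ X} (hM : IsClosed (M : Set X))
    (L : X →L[ℂ] X) (h : ∀ s ∈ S, L s ∈ M) {x : X} (hx : x ∈ cspan S) : L x ∈ M := by
  have : cspan S ≤ M.comap (L : X →ₗ[ℂ] X) := cspan_le (hM.preimage L.continuous) h
  exact this hx

lemma mul_mem_of_mem_cspan_left {S : Set X} {M : Submodule ℂ X} (hM : IsClosed (M : Set X))
    {y : X} (h : ∀ s ∈ S, s * y ∈ M) {x : X} (hx : x ∈ cspan S) : x * y ∈ M :=
  map_mem_of_mem_cspan hM ((ContinuousLinearMap.mul ℂ X).flip y) h hx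

lemma mul_mem_of_mem_cspan_right {S : Set X} {M : Submodule ℂ X} (hM : IsClosed (M : Set X))
    {x : X} (h : ∀ s ∈ S, x * s ∈ M) {y : X} (hy : y ∈ cspan S) : x * y ∈ M :=
  map_mem_of_mem_cspan hM (ContinuousLinearMap.mul ℂ X x) h hy

lemma star_mem_of_mem_cspan {S : Set X} {M : Submodule ℂ X} (hM : IsClosed (M : Set X))
    (h : ∀ s ∈ S, star s ∈ M) {x : X} (hx : x ∈ cspan S) : star x ∈ M := by
  let N : Submodule ℂ X :=
    { carrier := {x | star x ∈ M}
      zero_mem' := by simp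
      add_mem' := fun {a b} ha hb => by
        simpa using M.add_mem ha hb
      smul_mem' := fun c a ha => by
        simpa using M.smul_mem (star c) ha }
  have : cspan S ≤ N := cspan_le (hM.preimage continuous_star) h
  exact this hx

/-- The closed linear span of a set of products. -/
def cmul (S T : Set X) : Submodule ℂ X := cspan (MulSet2 S T)

lemma isClosed_cmul (S T : Set X) : IsClosed (cmul S T : Set X) := isClosed_cspan _

lemma mul_mem_cmul {S T : Set X} {s t : X} (hs : s ∈ S) (ht : t ∈ T) : s * t ∈ cmul S T :=
  subset_cspan _ ⟨s, hs, t, ht, rfl⟩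

lemma cmul_le {S T : Set X} {M : Submodule ℂ X} (hM : IsClosed (M : Set X))
    (h : ∀ s ∈ S, ∀ t ∈ T, s * t ∈ M) : cmul S T ≤ M :=
  cspan_le hM (by rintro _ ⟨s, hs, t, ht, rfl⟩; exact h s hs t ht)

lemma cmul_mono {S T S' T' : Set X} (hS : S ⊆ S') (hT : T ⊆ T') : cmul S T ≤ cmul S' T' :=
  cmul_le (isClosed_cmul _ _) fun _ hs _ ht => mul_mem_cmul (hS hs) (hT ht)

lemma mul_mem_cmul_univ {D : Set X} (x : X) {z : X} (hz : z ∈ cmul univ D) :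
    x * z ∈ cmul univ D :=
  mul_mem_of_mem_cspan_right (isClosed_cmul _ _) (by
    rintro _ ⟨s, hs, t, ht, rfl⟩
    rw [← mul_assoc]
    exact mul_mem_cmul (mem_univ _) ht) hz

lemma star_mem_cmul {S T S' T' : Set X} (hS : ∀ s ∈ S, star s ∈ S') (hT : ∀ t ∈ T, star t ∈ T')
    {z : X} (hz : z ∈ cmul S T) : star z ∈ cmul T' S' :=
  star_mem_of_mem_cspan (isClosed_cmul _ _) (by
    rintro _ ⟨s, hs, t, ht, rfl⟩
    rw [star_mul]
    exact mul_mem_cmul (hT t ht) (hS s hs)) hz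

/-- A contractive two-sided approximate unit of a subset. -/
structure IsApproxUnitOf (l : Filter X) (J : Set X) : Prop where
  neBot : l.NeBot
  mem : ∀ᶠ e in l, e ∈ J
  norm_le : ∀ᶠ e in l, ‖e‖ ≤ 1
  left : ∀ d ∈ J, Tendsto (fun e => e * d) l (𝓝 d)
  right : ∀ d ∈ J, Tendsto (fun e => d * e) l (𝓝 d)

lemma exists_approxUnit {J : Set X} (hc : IsClosed J) (hJ : IsStarSubalgebra J) :
    ∃ l : Filter X, IsApproxUnitOf l J := by
  let _ : NonUnitalCStarAlgebra X := {}
  let S : NonUnitalStarSubalgebra ℂ X :=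
    { carrier := J
      add_mem' := fun {a b} ha hb => hJ.1.2.1 a ha b hb
      zero_mem' := hJ.1.1
      mul_mem' := fun {a b} ha hb => hJ.1.2.2.2 a ha b hb
      smul_mem' := fun c x hx => hJ.1.2.2.1 c x hx
      star_mem' := fun {a} ha => hJ.2 a ha }
  have hS : IsClosed (S : Set X) := hc
  let _ : NonUnitalCStarAlgebra S := NonUnitalStarSubalgebra.nonUnitalCStarAlgebra S
  let _ : PartialOrder S := CStarAlgebra.spectralOrder S
  have _ : StarOrderedRing S := CStarAlgebra.spectralOrderedRing S
  have h := CStarAlgebra.increasingApproximateUnit S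
  refine ⟨map (fun e : S => (e : X)) (CStarAlgebra.approximateUnit S), ?_, ?_, ?_, ?_, ?_⟩
  · exact h.neBot.map _
  · exact eventually_map.mpr (Eventually.of_forall fun e => e.2)
  · exact h.eventually_norm
  · intro d hd
    have := h.tendsto_mul_right ⟨d, hd⟩
    rw [tendsto_map'_iff]
    exact (continuous_subtype_val.tendsto _).comp this
  · intro d hd
    have := h.tendsto_mul_left ⟨d, hd⟩
    rw [tendsto_map'_iff]
    exact (continuous_subtype_val.tendsto _).comp this

variable {l : Filter X} {J : Set X}

lemma tendsto_of_tendsto_on_cspan {l : Filter X} (L : X → X →L[ℂ] X)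
    (hb : ∀ᶠ e in l, ‖L e‖ ≤ 1) {S : Set X} (h : ∀ s ∈ S, Tendsto (fun e => L e s) l (𝓝 s))
    {z : X} (hz : z ∈ cspan S) : Tendsto (fun e => L e z) l (𝓝 z) := by
  let N : Submodule ℂ X :=
    { carrier := {x | Tendsto (fun e => L e x) l (𝓝 x)}
      zero_mem' := by
        change Tendsto _ _ _
        simpa using tendsto_const_nhds
      add_mem' := fun {a b} (ha : Tendsto _ _ _) (hb : Tendsto _ _ _) => by
        change Tendsto _ _ _
        simpa using ha.add hb
      smul_mem' := fun c a (ha : Tendsto _ _ _) => by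
        change Tendsto _ _ _
        simpa using ha.const_smul c }
  have hN : IsClosed (N : Set X) := by
    refine isClosed_of_closure_subset fun x hx => ?_
    change Tendsto _ _ _
    rw [Metric.tendsto_nhds]
    intro ε hε
    obtain ⟨y, hy, hxy⟩ := Metric.mem_closure_iff.mp hx (ε / 3) (by positivity)
    filter_upwards [Metric.tendsto_nhds.mp (show Tendsto (fun e => L e y) l (𝓝 y) from hy)
      (ε / 3) (by positivity), hb] with e he hn
    have h1 : dist (L e x) (L e y) ≤ dist x y := by
      rw [dist_eq_norm, dist_eq_norm, ← _root_.map_sub]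
      exact ((L e).le_of_opNorm_le hn _).trans (by simp)
    calc dist (L e x) x ≤ dist (L e x) (L e y) + dist (L e y) y + dist y x :=
          dist_triangle4 _ _ _ _
      _ < ε := by rw [dist_comm y x]; linarith
  have : cspan S ≤ N := cspan_le hN h
  exact this hz

lemma IsApproxUnitOf.left_cmul (h : IsApproxUnitOf l J) {T : Set X} {z : X} (hz : z ∈ cmul J T) :
    Tendsto (fun e => e * z) l (𝓝 z) := by
  refine tendsto_of_tendsto_on_cspan (fun e => ContinuousLinearMap.mul ℂ X e) ?_ ?_ hz
  · filter_upwards [h.norm_le] with e he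
    exact (ContinuousLinearMap.opNorm_mul_apply_le ℂ X e).trans he
  · rintro _ ⟨s, hs, t, ht, rfl⟩
    simp only [ContinuousLinearMap.mul_apply', ← mul_assoc]
    exact (h.left s hs).mul_const t

lemma IsApproxUnitOf.right_cmul (h : IsApproxUnitOf l J) {T : Set X} {z : X} (hz : z ∈ cmul T J) :
    Tendsto (fun e => z * e) l (𝓝 z) := by
  refine tendsto_of_tendsto_on_cspan (fun e => (ContinuousLinearMap.mul ℂ X).flip e) ?_ ?_ hz
  · filter_upwards [h.norm_le] with e he
    refine ContinuousLinearMap.opNorm_le_bound _ zero_le_one fun x => ?_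
    simp only [ContinuousLinearMap.flip_apply, ContinuousLinearMap.mul_apply']
    refine (norm_mul_le _ _).trans ?_
    rw [mul_comm]
    exact mul_le_mul_of_nonneg_right he (norm_nonneg _)
  · rintro _ ⟨s, hs, t, ht, rfl⟩
    simp only [ContinuousLinearMap.flip_apply, ContinuousLinearMap.mul_apply', mul_assoc]
    exact (h.right t ht).const_mul s

/-- If a closed star-subalgebra acts nondegenerately on `z`, then `z` lies in every closed
submodule containing the products. -/
lemma mem_of_mul_mem_left (hc : IsClosed J) (hJ : IsStarSubalgebra J) {T : Set X} {z : X}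
    (hz : z ∈ cmul J T) {M : Set X} (hM : IsClosed M) (h : ∀ e ∈ J, e * z ∈ M) :
    z ∈ M := by
  obtain ⟨l, hl⟩ := exists_approxUnit hc hJ
  have := hl.neBot
  exact hM.mem_of_tendsto (hl.left_cmul hz) (hl.mem.mono fun e he => h e he)

lemma mem_of_mul_mem_right (hc : IsClosed J) (hJ : IsStarSubalgebra J) {T : Set X} {z : X}
    (hz : z ∈ cmul T J) {M : Set X} (hM : IsClosed M) (h : ∀ e ∈ J, z * e ∈ M) :
    z ∈ M := by
  obtain ⟨l, hl⟩ := exists_approxUnit hc hJ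
  have := hl.neBot
  exact hM.mem_of_tendsto (hl.right_cmul hz) (hl.mem.mono fun e he => h e he)

/-- A closed star-subalgebra is contained in the closed span of its products. -/
lemma mem_cmul_self (hc : IsClosed J) (hJ : IsStarSubalgebra J) {z : X} (hz : z ∈ J) :
    z ∈ cmul J J := by
  obtain ⟨l, hl⟩ := exists_approxUnit hc hJ
  have := hl.neBot
  exact (isClosed_cmul J J).mem_of_tendsto (hl.left z hz)
    (hl.mem.mono fun e he => mul_mem_cmul he hz)

end ApproxUnit

/-! ### Fixed points and spectral gaps -/

section GapSection

variable {α : ℝ → X → X}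

lemma IsCStarDynSys.smear_ker_sub_smear (hα : IsCStarDynSys α) {φ ψ : ℝ → ℂ} (hφ : IsTest φ)
    (hψ : IsTest ψ) (x : X) : smear α (ker φ) (x - smear α (ker ψ) x) =
      smear α (ker fun γ => φ γ * (1 - ψ γ)) x := by
  have h1 := (hα.smearL hφ.integrable_ker).map_sub x (smear α (ker ψ) x)
  simp only [hα.smearL_apply] at h1
  rw [h1, hα.smear_ker_ker hφ hψ, ← hα.smear_ker_sub hφ (hφ.mul hψ.1)]
  congr 2; ext γ; ring

lemma IsCStarDynSys.sub_smear_mem_specC (hα : IsCStarDynSys α) {ψ : ℝ → ℂ} (hψ : IsTest ψ)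
    {F : Set ℝ} (hF : IsClosed F) {x : X}
    (h : ∀ γ ∈ elemSpec α x, γ ∉ F → ∀ᶠ z in 𝓝 γ, ψ z = 1) :
    x - smear α (ker ψ) x ∈ specC α F := by
  refine (hα.mem_specC_iff hF).mpr fun φ hφ hd => ?_
  rw [hα.smear_ker_sub_smear hφ hψ]
  refine hα.smear_ker_eq_zero (hφ.one_sub_mul hψ) (disjoint_left.mpr fun γ hγ hγx => ?_)
  have h1 := h γ hγx (disjoint_left.mp hd
    (closure_mono (Function.support_mul_subset_left _ _) hγ))
  refine (notMem_tsupport_iff_eventuallyEq.mpr ?_) hγ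
  filter_upwards [h1] with z hz
  simp [hz]

lemma IsCStarDynSys.specC_zero (hα : IsCStarDynSys α) : specC α {0} = fixedPts α := by
  ext x
  constructor
  · intro hx t
    obtain ⟨χ, hχ, hχ1⟩ := exists_bump
    have h1 : ∀ δ : ℝ, 0 < δ → smear α (ker fun γ => χ ((γ - 0) / δ)) x = x := by
      intro δ hδ
      refine hα.smear_ker_eq_self (hχ.comp_scale 0 hδ)
        (Eventually.filter_mono (nhdsSet_mono hx) ?_)
      rw [nhdsSet_singleton]
      filter_upwards [Metric.ball_mem_nhds (0 : ℝ) hδ] with γ hγ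
      rw [Metric.mem_ball, Real.dist_eq] at hγ
      refine hχ1 _ ?_
      rw [abs_div, abs_of_pos hδ, div_le_one hδ]
      exact hγ.le
    have h2 : ∀ᶠ δ : ℝ in 𝓝[>] 0,
        ‖α t x - x‖ ≤ (∫ u, ‖ker χ (u - δ * t) - ker χ u‖) * ‖x‖ := by
      filter_upwards [self_mem_nhdsWithin] with δ hδ
      simpa using hα.approx_eigen hχ hδ (h1 δ hδ) t
    have h3 : Tendsto (fun δ : ℝ => δ * t) (𝓝[>] 0) (𝓝 0) := by
      have : Continuous fun δ : ℝ => δ * t := by fun_prop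
      simpa using (this.tendsto 0).mono_left nhdsWithin_le_nhds
    have h4 := (hχ.tendsto_translation.comp h3).mul_const ‖x‖
    rw [zero_mul] at h4
    have h5 := ge_of_tendsto h4 h2
    exact sub_eq_zero.mp (norm_le_zero_iff.mp h5)
  · intro hx
    refine (hα.mem_specC_iff isClosed_singleton).mpr fun φ hφ hd => ?_
    have h0 : φ 0 = 0 := image_eq_zero_of_notMem_tsupport (disjoint_singleton_right.mp hd)
    have h1 := hφ.fourierT_ker 0
    rw [fourierT] at h1
    simp only [Complex.ofReal_zero, mul_zero, zero_mul, neg_zero, Complex.exp_zero, mul_one] at h1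
    rw [smear]
    simp only [show ∀ t, α t x = x from hx]
    rw [integral_smul_const, h1, h0, zero_smul]

lemma IsCStarDynSys.elemSpec_subset_actSpec (hα : IsCStarDynSys α) (x : X) :
    elemSpec α x ⊆ actSpec α univ := by
  intro γ hγ ε hε hcon
  obtain ⟨φ, hφ, h1, hs⟩ := exists_test_at (Metric.isOpen_ball (x := γ) (ε := ε))
    (Metric.mem_ball_self hε)
  have hm : smear α (ker φ) x ∈ (univ : Set X) ∩ specC α (Icc (γ - ε) (γ + ε)) := by
    refine ⟨mem_univ _, (hα.elemSpec_smear_ker hφ x).trans (hs.trans ?_)⟩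
    rw [← Real.closedBall_eq_Icc]
    exact Metric.ball_subset_closedBall
  rw [hcon] at hm
  exact notMem_of_smear_ker hφ (by simp [h1]) hm hγ

lemma IsCStarDynSys.mem_of_smear_mem (hα : IsCStarDynSys α) {N : Set X} (hN : IsClosed N)
    {F U : Set ℝ} (hF : IsClosed F) (hU : IsOpen U) (hFU : F ⊆ U) {z : X} (hz : z ∈ specC α F)
    (h : ∀ φ, IsTest φ → tsupport φ ⊆ U → smear α (ker φ) z ∈ N) : z ∈ N := by
  obtain ⟨ψ, hψ, hψ1⟩ := exists_bump
  refine hN.mem_of_tendsto (hα.tendsto_smear_ker hψ (hψ1 0 (by simp)) z) ?_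
  filter_upwards [eventually_gt_atTop 0] with r hr
  have hψr := hψ.comp_scale 0 hr
  set ψ' := fun γ => ψ ((γ - 0) / r) with hψ'
  obtain ⟨η, hη, hη1, hηs⟩ := exists_test (hψr.2.inter_right hF) hU (inter_subset_right.trans hFU)
  have h1 : smear α (ker η) (smear α (ker ψ') z) = smear α (ker ψ') z := by
    refine hα.smear_ker_eq_self hη (hη1.filter_mono (nhdsSet_mono ?_))
    exact subset_inter (hα.elemSpec_smear_ker hψr z)
      ((hα.elemSpec_smear_subset hψr.integrable_ker z).trans hz)
  rw [← h1, hα.smear_ker_ker hη hψr]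
  exact h _ (hη.mul hψr.1)
    ((closure_mono (Function.support_mul_subset_left _ _)).trans hηs)

lemma IsCStarDynSys.smear_mem (hα : IsCStarDynSys α) {M : Submodule ℂ X}
    (hM : IsClosed (M : Set X)) (hinv : Invariant α (M : Set X)) {f : ℝ → ℂ} (hf : Integrable f)
    {x : X} (hx : x ∈ M) : smear α f x ∈ M := by
  have _ : IsClosed (M : Set X) := hM
  have h := M.mkQL.integral_comp_comm (hα.integrable hf x)
  have h0 : ∀ t, M.mkQL (f t • α t x) = 0 := fun t =>
    (Submodule.Quotient.mk_eq_zero M).mpr (M.smul_mem _ (hinv t x hx))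
  simp only [h0, integral_zero] at h
  exact (Submodule.Quotient.mk_eq_zero M).mp h.symm

lemma IsCStarDynSys.smear_mul_right (hα : IsCStarDynSys α) {f : ℝ → ℂ} (hf : Integrable f)
    (x : X) {d : X} (hd : d ∈ fixedPts α) : smear α f (x * d) = smear α f x * d := by
  have h1 := ((ContinuousLinearMap.mul ℂ X).flip d).integral_comp_comm (hα.integrable hf x)
  simp only [ContinuousLinearMap.flip_apply, ContinuousLinearMap.mul_apply'] at h1
  rw [smear, smear, ← h1]
  congr 1; ext t
  rw [hα.map_mul, hd t, smul_mul_assoc]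

lemma IsCStarDynSys.smear_mul_left (hα : IsCStarDynSys α) {f : ℝ → ℂ} (hf : Integrable f)
    (x : X) {d : X} (hd : d ∈ fixedPts α) : smear α f (d * x) = d * smear α f x := by
  have h1 := (ContinuousLinearMap.mul ℂ X d).integral_comp_comm (hα.integrable hf x)
  simp only [ContinuousLinearMap.mul_apply'] at h1
  rw [smear, smear, ← h1]
  congr 1; ext t
  rw [hα.map_mul, hd t, mul_smul_comm]

lemma IsCStarDynSys.isStarSubalgebra_fixedPts (hα : IsCStarDynSys α) :
    IsStarSubalgebra (fixedPts α) := by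
  refine ⟨⟨fun t => hα.map_zero t, fun x hx y hy t => ?_, fun c x hx t => ?_,
    fun x hx y hy t => ?_⟩, fun x hx t => ?_⟩
  · rw [hα.map_add, hx t, hy t]
  · rw [hα.map_smulc, hx t]
  · rw [hα.map_mul, hx t, hy t]
  · rw [hα.map_star, hx t]

/-- A one-parameter system whose spectrum has the gaps `(-lam, 0)` and `(0, lam)`. -/
structure Gap (α : ℝ → X → X) (lam : ℝ) : Prop where
  sys : IsCStarDynSys α
  pos : 0 < lam
  gap : ∀ x, elemSpec α x ⊆ Iic (-lam) ∪ {0} ∪ Ici lam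

namespace Gap

variable {lam : ℝ}

lemma mem_specC (G : Gap α lam) {F F' : Set ℝ} {x : X} (hx : x ∈ specC α F)
    (h : ∀ γ ∈ F, (γ ≤ -lam ∨ γ = 0 ∨ lam ≤ γ) → γ ∈ F') : x ∈ specC α F' := by
  intro γ hγ
  refine h γ (hx hγ) ?_
  rcases G.gap x hγ with (h1 | h1) | h1
  · exact Or.inl h1
  · exact Or.inr (Or.inl h1)
  · exact Or.inr (Or.inr h1)

lemma mem_fixedPts (G : Gap α lam) {F : Set ℝ} {x : X} (hx : x ∈ specC α F)
    (h : ∀ γ ∈ F, -lam < γ ∧ γ < lam) : x ∈ fixedPts α := by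
  rw [← G.sys.specC_zero]
  refine G.mem_specC hx fun γ hγ h1 => ?_
  have := h γ hγ
  rcases h1 with h1 | h1 | h1
  · linarith
  · exact h1
  · linarith

lemma reverse (G : Gap α lam) : Gap (fun t => α (-t)) lam where
  sys := G.sys.reverse
  pos := G.pos
  gap x γ hγ := by
    rw [elemSpec_reverse, Set.mem_neg] at hγ
    rcases G.gap x hγ with (h1 | h1) | h1
    · exact Or.inr (by simpa using h1)
    · exact Or.inl (Or.inr (by simpa using h1))
    · exact Or.inl (Or.inl (by rw [mem_Iic]; rw [mem_Ici] at h1; linarith))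

lemma exists_symbol (G : Gap α lam) : ∃ φ, IsTest φ ∧ (∀ᶠ γ in 𝓝 (0 : ℝ), φ γ = 1) ∧
    tsupport φ ⊆ Ioo (-lam) lam := by
  obtain ⟨φ, h, h1, h2⟩ := exists_test (isCompact_singleton (x := (0 : ℝ)))
    (isOpen_Ioo (a := -lam) (b := lam)) (by simpa using G.pos)
  exact ⟨φ, h, by rwa [nhdsSet_singleton] at h1, h2⟩

/-- The symbol of the conditional expectation onto the fixed points. -/
def symbol (G : Gap α lam) : ℝ → ℂ := G.exists_symbol.choose

lemma isTest_symbol (G : Gap α lam) : IsTest G.symbol := G.exists_symbol.choose_spec.1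

lemma symbol_eq_one (G : Gap α lam) : ∀ᶠ γ in 𝓝 (0 : ℝ), G.symbol γ = 1 :=
  G.exists_symbol.choose_spec.2.1

lemma tsupport_symbol (G : Gap α lam) : tsupport G.symbol ⊆ Ioo (-lam) lam :=
  G.exists_symbol.choose_spec.2.2

/-- The conditional expectation onto the fixed points. -/
def expec (G : Gap α lam) : X →L[ℂ] X := G.sys.smearL G.isTest_symbol.integrable_ker

lemma expec_apply (G : Gap α lam) (x : X) : G.expec x = smear α (ker G.symbol) x := rfl

lemma expec_mem (G : Gap α lam) (x : X) : G.expec x ∈ fixedPts α :=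
  G.mem_fixedPts (G.sys.elemSpec_smear_ker G.isTest_symbol x) fun _ hγ => G.tsupport_symbol hγ

lemma integral_symbol (G : Gap α lam) : ∫ t, ker G.symbol t = 1 := by
  have h1 := G.isTest_symbol.fourierT_ker 0
  rw [fourierT, G.symbol_eq_one.self_of_nhds] at h1
  simpa using h1

lemma expec_fixed (G : Gap α lam) {x : X} (hx : x ∈ fixedPts α) : G.expec x = x := by
  rw [expec_apply, smear]
  simp only [show ∀ t, α t x = x from hx]
  rw [integral_smul_const, G.integral_symbol, one_smul]

lemma expec_mul_right (G : Gap α lam) (x : X) {d : X} (hd : d ∈ fixedPts α) :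
    G.expec (x * d) = G.expec x * d := G.sys.smear_mul_right G.isTest_symbol.integrable_ker x hd

lemma expec_mul_left (G : Gap α lam) (x : X) {d : X} (hd : d ∈ fixedPts α) :
    G.expec (d * x) = d * G.expec x := G.sys.smear_mul_left G.isTest_symbol.integrable_ker x hd

lemma sub_expec_mem (G : Gap α lam) {F F' : Set ℝ} (hF' : IsClosed F') {x : X}
    (hx : x ∈ specC α F) (h : ∀ γ ∈ F, (γ ≤ -lam ∨ lam ≤ γ) → γ ∈ F') :
    x - G.expec x ∈ specC α F' := by
  refine G.sys.sub_smear_mem_specC G.isTest_symbol hF' fun γ hγ hn => ?_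
  rcases G.gap x hγ with (h1 | h1) | h1
  · exact absurd (h γ (hx hγ) (Or.inl h1)) hn
  · rw [mem_singleton_iff] at h1
    rw [h1]
    exact G.symbol_eq_one
  · exact absurd (h γ (hx hγ) (Or.inr h1)) hn

lemma expec_mem_of_mem (G : Gap α lam) {M : Submodule ℂ X} (hM : IsClosed (M : Set X))
    (hinv : Invariant α (M : Set X)) {x : X} (hx : x ∈ M) : G.expec x ∈ M :=
  G.sys.smear_mem hM hinv G.isTest_symbol.integrable_ker hx

/-- A closed subspace containing all negative, fixed and positive elements is everything. -/
lemma mem_of_forall (G : Gap α lam) {N : Submodule ℂ X} (hN : IsClosed (N : Set X))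
    (hneg : specC α (Iic (-lam)) ⊆ N) (h0 : fixedPts α ⊆ N) (hpos : specC α (Ici lam) ⊆ N)
    (x : X) : x ∈ N := by
  obtain ⟨ψ, hψ, hψ1⟩ := exists_bump
  refine hN.mem_of_tendsto (G.sys.tendsto_smear_ker hψ (hψ1 0 (by simp)) x) ?_
  filter_upwards [eventually_gt_atTop 0] with r hr
  have hψr := hψ.comp_scale 0 hr
  set ψ' := fun γ => ψ ((γ - 0) / r) with hψ'
  set z := smear α (ker ψ') x with hz
  obtain ⟨η, hη, hη1, hηs⟩ := exists_test (hψr.2.inter_right (isClosed_Ici (a := lam)))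
    (isOpen_Ioi (a := 0)) (fun γ hγ => G.pos.trans_le hγ.2)
  have h1 : smear α (ker η) z ∈ specC α (Ici lam) := by
    refine G.mem_specC (F := Ioi 0) ((G.sys.elemSpec_smear_ker hη z).trans hηs) fun γ hγ h => ?_
    rw [mem_Ioi] at hγ
    rcases h with h | h | h
    · linarith [G.pos]
    · linarith
    · exact h
  have h2 : z - smear α (ker η) z ∈ specC α (Iic 0) := by
    refine G.sys.sub_smear_mem_specC hη isClosed_Iic fun γ hγ hn => ?_
    refine (eventually_nhdsSet_iff_forall.mp hη1) γ ⟨G.sys.elemSpec_smear_ker hψr x hγ, ?_⟩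
    rw [mem_Iic, not_le] at hn
    rcases G.gap z hγ with (h1 | h1) | h1
    · rw [mem_Iic] at h1; linarith [G.pos]
    · rw [mem_singleton_iff] at h1; linarith
    · exact h1
  have h3 : z - smear α (ker η) z - G.expec (z - smear α (ker η) z) ∈ specC α (Iic (-lam)) := by
    refine G.sub_expec_mem isClosed_Iic h2 fun γ hγ h => ?_
    rw [mem_Iic] at *
    rcases h with h | h
    · exact h
    · linarith [G.pos]
  have : z = (z - smear α (ker η) z - G.expec (z - smear α (ker η) z)) +
      G.expec (z - smear α (ker η) z) + smear α (ker η) z := by abel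
  rw [this]
  exact N.add_mem (N.add_mem (hneg h3) (h0 (G.expec_mem _))) (hpos h1)

lemma exists_fixed_seq (G : Gap α lam) {B : Submodule ℂ X} (hc : IsClosed (B : Set X))
    (hB : IsStarSubalgebra (B : Set X)) (hinv : Invariant α (B : Set X)) {b : X} (hb : b ∈ B) :
    ∃ u : ℕ → X, (∀ n, u n ∈ B ∧ u n ∈ fixedPts α) ∧ Tendsto (fun n => u n * b) atTop (𝓝 b) := by
  obtain ⟨l, hl⟩ := exists_approxUnit hc hB
  have := hl.neBot
  have hunif : ∀ n : ℕ, ∃ e ∈ B, ‖e‖ ≤ 1 ∧ ∀ t : ℝ, |t| ≤ n →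
      ‖e * α t b - α t b‖ ≤ 3 * (1 / ((n : ℝ) + 1)) := by
    intro n
    set ε : ℝ := 1 / ((n : ℝ) + 1) with hε
    have hε0 : 0 < ε := by positivity
    have hK : IsCompact ((fun t => α t b) '' Icc (-(n : ℝ)) n) :=
      isCompact_Icc.image (G.sys.continuous_orbit b)
    obtain ⟨s, hs, hsf, hcov⟩ := hK.finite_cover_balls hε0
    have hev : ∀ᶠ e in l, ∀ y ∈ s, dist (e * y) y < ε := by
      rw [eventually_all_finite hsf]
      intro y hy
      obtain ⟨t, -, rfl⟩ := hs hy
      exact Metric.tendsto_nhds.mp (hl.left _ (hinv t b hb)) ε hε0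
    obtain ⟨e, ⟨he, heB⟩, hen⟩ := ((hev.and hl.mem).and hl.norm_le).exists
    refine ⟨e, heB, hen, fun t ht => ?_⟩
    have hmem : α t b ∈ (fun t => α t b) '' Icc (-(n : ℝ)) n := ⟨t, abs_le.mp ht, rfl⟩
    obtain ⟨y, hy, hty⟩ := mem_iUnion₂.mp (hcov hmem)
    rw [Metric.mem_ball, dist_eq_norm] at hty
    have h1 := he y hy
    rw [dist_eq_norm] at h1
    have h2 : ‖e * (α t b - y)‖ ≤ ‖α t b - y‖ :=
      (norm_mul_le _ _).trans (mul_le_of_le_one_left (norm_nonneg _) hen)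
    have h3 : e * α t b - α t b = e * (α t b - y) + (e * y - y) - (α t b - y) := by
      rw [mul_sub]; abel
    rw [h3]
    refine (norm_sub_le _ _).trans ?_
    have := norm_add_le (e * (α t b - y)) (e * y - y)
    linarith
  choose e heB hen hec using hunif
  refine ⟨fun n => G.expec (e n), fun n => ⟨G.expec_mem_of_mem hc hinv (heB n), G.expec_mem _⟩, ?_⟩
  have hlim : Tendsto (fun n => ∫ t, ker G.symbol t • (α t (e n) * b)) atTop
      (𝓝 (∫ t, ker G.symbol t • b)) := by
    have hk := G.isTest_symbol.integrable_ker
    refine tendsto_integral_of_dominated_convergence (fun t => ‖ker G.symbol t‖ * ‖b‖) ?_ ?_ ?_ ?_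
    · intro n
      exact hk.aestronglyMeasurable.smul
        (((G.sys.continuous_orbit (e n)).mul continuous_const).aestronglyMeasurable)
    · exact hk.norm.mul_const _
    · intro n
      refine Eventually.of_forall fun t => ?_
      rw [norm_smul]
      refine mul_le_mul_of_nonneg_left ((norm_mul_le _ _).trans ?_) (norm_nonneg _)
      exact mul_le_of_le_one_left (norm_nonneg _) ((G.sys.norm_le _ _).trans (hen n))
    · refine Eventually.of_forall fun t => Tendsto.const_smul ?_ _
      rw [tendsto_iff_norm_sub_tendsto_zero]
      have h0 : Tendsto (fun n : ℕ => 3 * (1 / ((n : ℝ) + 1))) atTop (𝓝 0) := by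
        simpa using (tendsto_one_div_add_atTop_nhds_zero_nat (𝕜 := ℝ)).const_mul 3
      refine tendsto_of_tendsto_of_tendsto_of_le_of_le' tendsto_const_nhds h0
        (Eventually.of_forall fun n => norm_nonneg _) ?_
      filter_upwards [eventually_ge_atTop ⌈|t|⌉₊] with n hn
      have h1 : |-t| ≤ n := by rw [abs_neg]; exact Nat.ceil_le.mp hn
      have h2 : α t (e n) * b - b = α t (e n * α (-t) b - α (-t) b) := by
        rw [G.sys.map_sub, G.sys.map_mul, ← G.sys.map_add_time, add_neg_cancel,
          G.sys.map_zero_time]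
      rw [h2]
      exact (G.sys.norm_le _ _).trans (hec n _ h1)
  rw [integral_smul_const, G.integral_symbol, one_smul] at hlim
  refine hlim.congr fun n => ?_
  have h1 := ((ContinuousLinearMap.mul ℂ X).flip b).integral_comp_comm
    (G.sys.integrable G.isTest_symbol.integrable_ker (e n))
  simp only [ContinuousLinearMap.flip_apply, ContinuousLinearMap.mul_apply'] at h1
  change _ = smear α (ker G.symbol) (e n) * b
  rw [smear, ← h1]
  congr 1; ext t
  rw [smul_mul_assoc]

lemma mem_of_fixed_mul_mem (G : Gap α lam) {B : Submodule ℂ X} (hc : IsClosed (B : Set X))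
    (hB : IsStarSubalgebra (B : Set X)) (hinv : Invariant α (B : Set X)) {b : X} (hb : b ∈ B)
    {M : Set X} (hM : IsClosed M) (h : ∀ c ∈ B, c ∈ fixedPts α → c * b ∈ M) : b ∈ M := by
  obtain ⟨u, hu, hlim⟩ := G.exists_fixed_seq hc hB hinv hb
  exact hM.mem_of_tendsto hlim (Eventually.of_forall fun n => h _ (hu n).1 (hu n).2)

lemma mem_of_mul_fixed_mem (G : Gap α lam) {B : Submodule ℂ X} (hc : IsClosed (B : Set X))
    (hB : IsStarSubalgebra (B : Set X)) (hinv : Invariant α (B : Set X)) {b : X} (hb : b ∈ B)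
    {M : Set X} (hM : IsClosed M) (h : ∀ c ∈ B, c ∈ fixedPts α → b * c ∈ M) : b ∈ M := by
  have := G.mem_of_fixed_mul_mem hc hB hinv (hB.2 b hb) (hM.preimage continuous_star)
    fun c hc hcf => by
      have := h (star c) (hB.2 c hc) (G.sys.isStarSubalgebra_fixedPts.2 c hcf)
      simpa using this
  simpa using this

end Gap

end GapSection

/-! ### Consequences of maximality -/

section MaxGapSection

variable {α : ℝ → X → X}

/-- A gapped system whose analytic algebra is maximal and whose spectrum accumulates at, or
contains, the edge `lam` of the gap. -/
structure MaxGap (α : ℝ → X → X) (lam : ℝ) : Prop extends Gap α lam where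
  max : ∀ W : Set X, IsClosed W → IsSubalgebra W → specC α (Ici 0) ⊆ W →
    W = specC α (Ici 0) ∨ W = univ
  bottom : ∀ δ > 0, ∃ x ∈ specC α (Icc lam (lam + δ)), x ≠ 0

/-- The closed span of `x * y` with `x`, `y` having spectrum in `[lam, lam + δ]` and its
negative. -/
def jay (α : ℝ → X → X) (lam δ : ℝ) : Submodule ℂ X :=
  cmul (specC α (Icc lam (lam + δ))) (specC α (Icc (-lam - δ) (-lam)))

lemma isClosed_jay (lam δ : ℝ) : IsClosed (jay α lam δ : Set X) := isClosed_cmul _ _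

namespace MaxGap

variable {lam δ : ℝ}

lemma reverse (G : MaxGap α lam) : MaxGap (fun t => α (-t)) lam where
  toGap := G.toGap.reverse
  max W hc hW hsub := by
    rw [specC_reverse] at hsub ⊢
    have hneg : -(Ici (0 : ℝ)) = Iic 0 := by ext; simp
    rw [hneg] at hsub ⊢
    have h1 : ∀ {x}, x ∈ specC α (Ici 0) → star x ∈ specC α (Iic 0) := fun hx =>
      G.sys.star_mem_specC' (fun γ hγ => by simpa using hγ) hx
    have h2 : ∀ {x}, x ∈ specC α (Iic 0) → star x ∈ specC α (Ici 0) := fun hx =>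
      G.sys.star_mem_specC' (fun γ hγ => by simpa using hγ) hx
    have hW' : IsSubalgebra (star ⁻¹' W) := by
      obtain ⟨w0, w1, w2, w3⟩ := hW
      refine ⟨by simpa using w0, fun x hx y hy => ?_, fun c x hx => ?_, fun x hx y hy => ?_⟩
      · simpa using w1 _ hx _ hy
      · simpa using w2 (star c) _ hx
      · simpa using w3 _ hy _ hx
    rcases G.max (star ⁻¹' W) (hc.preimage continuous_star) hW' (fun x hx => hsub (h1 hx))
      with h | h
    · left
      ext x
      have h3 : star x ∈ star ⁻¹' W ↔ star x ∈ specC α (Ici 0) := by rw [h]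
      rw [mem_preimage, star_star] at h3
      rw [h3]
      exact ⟨fun hx => by simpa using h1 hx, h2⟩
    · right
      refine eq_univ_of_forall fun x => ?_
      have : star x ∈ star ⁻¹' W := by rw [h]; trivial
      simpa using this
  bottom δ hδ := by
    obtain ⟨x, hx, hne⟩ := G.bottom δ hδ
    refine ⟨star x, ?_, by simpa using hne⟩
    rw [specC_reverse]
    exact G.sys.star_mem_specC hx

lemma star_up (G : MaxGap α lam) {x : X} (hx : x ∈ specC α (Icc lam (lam + δ))) :
    star x ∈ specC α (Icc (-lam - δ) (-lam)) :=
  G.sys.star_mem_specC' (F := Icc lam (lam + δ)) (G := Icc (-lam - δ) (-lam))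
    (fun γ hγ => ⟨by linarith [hγ.2], by linarith [hγ.1]⟩) hx

lemma star_down (G : MaxGap α lam) {x : X} (hx : x ∈ specC α (Icc (-lam - δ) (-lam))) :
    star x ∈ specC α (Icc lam (lam + δ)) :=
  G.sys.star_mem_specC' (F := Icc (-lam - δ) (-lam)) (G := Icc lam (lam + δ))
    (fun γ hγ => ⟨by linarith [hγ.2], by linarith [hγ.1]⟩) hx

lemma fixed_mem (G : MaxGap α lam) {x : X} (hx : x ∈ fixedPts α) : x ∈ specC α {0} := by
  rwa [G.sys.specC_zero]

lemma fixed_mul (G : MaxGap α lam) {F : Set ℝ} (hF : IsClosed F) {d x : X} (hd : d ∈ fixedPts α)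
    (hx : x ∈ specC α F) : d * x ∈ specC α F :=
  G.sys.mul_mem_specC hF hF (fun a ha b hb => by rw [mem_singleton_iff.mp ha, zero_add]; exact hb)
    (G.fixed_mem hd) hx

lemma mul_fixed (G : MaxGap α lam) {F : Set ℝ} (hF : IsClosed F) {d x : X} (hd : d ∈ fixedPts α)
    (hx : x ∈ specC α F) : x * d ∈ specC α F :=
  G.sys.mul_mem_specC isClosed_singleton hF
    (fun a ha b hb => by rw [mem_singleton_iff.mp hb, add_zero]; exact ha) hx (G.fixed_mem hd)

lemma jay_fixed (G : MaxGap α lam) (hδ : δ < lam) {x : X} (hx : x ∈ jay α lam δ) :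
    x ∈ fixedPts α := by
  have : jay α lam δ ≤ G.sys.specM (isClosed_singleton (x := (0 : ℝ))) := by
    refine cmul_le (G.sys.isClosed_specC isClosed_singleton) fun s hs t ht => ?_
    have h1 := G.sys.mul_mem_specC isClosed_Icc (isClosed_Icc (a := -δ) (b := δ))
      (fun a ha b hb => ⟨by linarith [ha.1, hb.1], by linarith [ha.2, hb.2]⟩) hs ht
    exact G.fixed_mem (G.mem_fixedPts h1 fun γ hγ => ⟨by linarith [hγ.1], by linarith [hγ.2]⟩)
  rw [← G.sys.specC_zero]
  exact this hx

lemma jay_star (G : MaxGap α lam) {x : X} (hx : x ∈ jay α lam δ) : star x ∈ jay α lam δ :=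
  star_mem_cmul (fun _ hs => G.star_up hs) (fun _ hs => G.star_down hs) hx

lemma fixed_mul_jay (G : MaxGap α lam) {d x : X} (hd : d ∈ fixedPts α) (hx : x ∈ jay α lam δ) :
    d * x ∈ jay α lam δ := by
  refine mul_mem_of_mem_cspan_right (isClosed_jay _ _) ?_ hx
  rintro _ ⟨s, hs, t, ht, rfl⟩
  rw [← mul_assoc]
  exact mul_mem_cmul (G.fixed_mul isClosed_Icc hd hs) ht

lemma jay_mul_fixed (G : MaxGap α lam) {d x : X} (hd : d ∈ fixedPts α) (hx : x ∈ jay α lam δ) :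
    x * d ∈ jay α lam δ := by
  refine mul_mem_of_mem_cspan_left (isClosed_jay _ _) ?_ hx
  rintro _ ⟨s, hs, t, ht, rfl⟩
  rw [mul_assoc]
  exact mul_mem_cmul hs (G.mul_fixed isClosed_Icc hd ht)

lemma isStarSubalgebra_jay (G : MaxGap α lam) (hδ : δ < lam) :
    IsStarSubalgebra (jay α lam δ : Set X) :=
  ⟨⟨(jay α lam δ).zero_mem, fun _ hx _ hy => (jay α lam δ).add_mem hx hy,
    fun c _ hx => (jay α lam δ).smul_mem c hx,
    fun _ hx _ hy => G.fixed_mul_jay (G.jay_fixed hδ hx) hy⟩, fun _ hx => G.jay_star hx⟩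

lemma jay_ne (G : MaxGap α lam) (hδ : 0 < δ) : ∃ x ∈ jay α lam δ, x ≠ 0 := by
  obtain ⟨x, hx, hne⟩ := G.bottom δ hδ
  exact ⟨x * star x, mul_mem_cmul hx (G.star_up hx), by
    rwa [Ne, CStarRing.mul_star_self_eq_zero_iff]⟩

variable {D : Submodule ℂ X}

lemma fixed_mul_ideal (G : MaxGap α lam) (hδ : δ < lam) (hDc : IsClosed (D : Set X))
    (hDJ : D ≤ jay α lam δ) (hid : ∀ s ∈ jay α lam δ, ∀ d ∈ D, s * d ∈ D ∧ d * s ∈ D)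
    {x d : X} (hx : x ∈ fixedPts α) (hd : d ∈ D) : x * d ∈ D ∧ d * x ∈ D := by
  obtain ⟨l, hl⟩ := exists_approxUnit (isClosed_jay lam δ) (G.isStarSubalgebra_jay hδ)
  have := hl.neBot
  constructor
  · refine hDc.mem_of_tendsto ((hl.left d (hDJ hd)).const_mul x) (hl.mem.mono fun e he => ?_)
    rw [← mul_assoc]
    exact (hid _ (G.fixed_mul_jay hx he) d hd).1
  · refine hDc.mem_of_tendsto ((hl.right d (hDJ hd)).mul_const x) (hl.mem.mono fun e he => ?_)
    rw [mul_assoc]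
    exact (hid _ (G.jay_mul_fixed hx he) d hd).2

/-- Maximality of the analytic algebra forces every nonzero ideal of `jay` to be full. -/
lemma jay_simple_aux (G : MaxGap α lam) (hδ0 : 0 < δ) (hδ : δ < lam) (hDc : IsClosed (D : Set X))
    (hDJ : D ≤ jay α lam δ) (hid : ∀ s ∈ jay α lam δ, ∀ d ∈ D, s * d ∈ D ∧ d * s ∈ D)
    (hne : ∃ d ∈ D, d ≠ 0) :
    specC α (Iic (-lam)) ⊆ cmul univ (D : Set X) ∧ jay α lam δ ≤ D := by
  have hlam := G.pos
  have hfix : ∀ {x}, x ∈ fixedPts α → x ∈ specC α (Ici 0) := fun hx =>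
    specC_mono (by simp) (G.fixed_mem hx)
  set R := cmul univ (D : Set X) with hR
  set M := cspan (specC α (Ici 0) ∪ (R : Set X)) with hM
  have hMc : IsClosed (M : Set X) := isClosed_cspan _
  have hAM : ∀ {a}, a ∈ specC α (Ici 0) → a ∈ M := fun ha => subset_cspan _ (Or.inl ha)
  have hRM : ∀ {a}, a ∈ R → a ∈ M := fun ha => subset_cspan _ (Or.inr ha)
  set W : Set X := {x | ∀ m ∈ M, x * m ∈ M} with hW
  have hWR : ∀ {x}, (∀ a ∈ specC α (Ici 0), x * a ∈ M) → x ∈ W := fun {x} h m hm => by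
    refine mul_mem_of_mem_cspan_right hMc ?_ hm
    rintro s (hs | hs)
    · exact h s hs
    · exact hRM (mul_mem_cmul_univ x hs)
  have hWc : IsClosed W := by
    have : W = ⋂ m ∈ M, (fun x => x * m) ⁻¹' (M : Set X) := by
      ext x; simp [hW]
    rw [this]
    exact isClosed_biInter fun m _ => hMc.preimage (continuous_id.mul continuous_const)
  have hWalg : IsSubalgebra W := by
    refine ⟨fun m _ => by simp, fun x hx y hy m hm => ?_, fun c x hx m hm => ?_,
      fun x hx y hy m hm => ?_⟩
    · rw [add_mul]; exact M.add_mem (hx m hm) (hy m hm)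
    · rw [smul_mul_assoc]; exact M.smul_mem c (hx m hm)
    · rw [mul_assoc]; exact hx _ (hy m hm)
  have hAW : specC α (Ici 0) ⊆ W := fun x hx => hWR fun a ha =>
    hAM (G.sys.mul_mem_specC (F₂ := Ici 0) (G := Ici 0) isClosed_Ici isClosed_Ici
      (fun a ha b hb => by rw [mem_Ici] at *; linarith) hx ha)
  have hex : ∃ x ∈ specC α (Icc (-lam - δ) (-lam)), ∃ d ∈ D, x * d ≠ 0 := by
    obtain ⟨d, hd, hd0⟩ := hne
    by_contra hcon
    push Not at hcon
    refine hd0 ?_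
    have h1 : d ∈ ((⊥ : Submodule ℂ X) : Set X) := by
      refine mem_of_mul_mem_left (isClosed_jay lam δ) (G.isStarSubalgebra_jay hδ)
        (mem_cmul_self (isClosed_jay lam δ) (G.isStarSubalgebra_jay hδ) (hDJ hd))
        (by simp) fun e he => ?_
      refine mul_mem_of_mem_cspan_left (by simp) ?_ he
      rintro _ ⟨s, hs, t, ht, rfl⟩
      rw [mul_assoc, hcon t ht d hd, mul_zero]
      exact Submodule.zero_mem _
    simpa using h1
  have hWu : W = univ := by
    refine (G.max W hWc hWalg hAW).resolve_left fun hWA => ?_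
    obtain ⟨x, hx, d, hd, hxd⟩ := hex
    have hdf := G.jay_fixed hδ (hDJ hd)
    have hxdm : x * d ∈ specC α (Icc (-lam - δ) (-lam)) := G.mul_fixed isClosed_Icc hdf hx
    have hmem : x * d ∈ W := by
      refine hWR fun a ha => ?_
      have h1 : x * d * G.expec a ∈ M := by
        rw [mul_assoc]
        exact hRM (mul_mem_cmul (mem_univ _)
          (G.fixed_mul_ideal hδ hDc hDJ hid (G.expec_mem a) hd).2)
      have h2 : a - G.expec a ∈ specC α (Ici lam) :=
        G.sub_expec_mem isClosed_Ici ha fun γ hγ h => by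
          rw [mem_Ici] at *
          rcases h with h | h
          · linarith
          · exact h
      have h3 : x * d * (a - G.expec a) ∈ specC α (Ici (-δ)) :=
        G.sys.mul_mem_specC isClosed_Ici isClosed_Ici
          (fun a ha b hb => by rw [mem_Ici] at *; linarith [ha.1]) hxdm h2
      have h4 : x * d * (a - G.expec a) ∈ M := hAM <| G.mem_specC h3 fun γ hγ h => by
        rw [mem_Ici] at *
        rcases h with h | h | h <;> linarith
      have := M.add_mem h1 h4
      rwa [← mul_add, add_sub_cancel] at this
    rw [hWA] at hmem
    refine hxd (G.sys.eq_zero_of_elemSpec_eq_empty (subset_empty_iff.mp fun γ hγ => ?_))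
    have h1 := hmem hγ
    have h2 := (hxdm hγ).2
    rw [mem_Ici] at h1
    linarith
  have hall : ∀ z, z ∈ M := fun z => by
    refine G.mem_of_mul_fixed_mem (B := ⊤) isClosed_univ
      ⟨⟨trivial, fun _ _ _ _ => trivial, fun _ _ _ => trivial, fun _ _ _ _ => trivial⟩,
        fun _ _ => trivial⟩ (fun _ _ _ => trivial) trivial hMc fun c _ hc => ?_
    have : z ∈ W := by rw [hWu]; trivial
    exact this c (hAM (hfix hc))
  have hneg : specC α (Iic (-lam)) ⊆ R := by
    intro z hz
    refine G.sys.mem_of_smear_mem (isClosed_cmul _ _) isClosed_Iic (isOpen_Iio (a := 0))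
      (fun γ hγ => by rw [mem_Iio]; rw [mem_Iic] at hγ; linarith) hz fun φ hφ hs => ?_
    refine map_mem_of_mem_cspan (isClosed_cmul _ _) (G.sys.smearL hφ.integrable_ker) ?_ (hall z)
    rintro s (hs' | hs')
    · rw [G.sys.smearL_apply, (G.sys.mem_specC_iff isClosed_Ici).mp hs' φ hφ]
      · exact Submodule.zero_mem _
      · refine disjoint_left.mpr fun γ hγ hγ' => ?_
        exact not_lt.mpr (mem_Ici.mp hγ') (mem_Iio.mp (hs hγ))
    · refine map_mem_of_mem_cspan (isClosed_cmul _ _) (G.sys.smearL hφ.integrable_ker) ?_ hs'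
      rintro _ ⟨x, -, d, hd, rfl⟩
      rw [G.sys.smearL_apply, G.sys.smear_mul_right hφ.integrable_ker _ (G.jay_fixed hδ (hDJ hd))]
      exact mul_mem_cmul (mem_univ _) hd
  refine ⟨hneg, fun j hj => ?_⟩
  have hjR : j ∈ R := by
    have : jay α lam δ ≤ R := cmul_le (isClosed_cmul _ _) fun s _ t ht =>
      mul_mem_cmul_univ s (hneg (specC_mono (fun γ hγ => hγ.2) ht))
    exact this hj
  rw [← G.expec_fixed (G.jay_fixed hδ hj)]
  refine map_mem_of_mem_cspan hDc G.expec ?_ hjR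
  rintro _ ⟨x, -, d, hd, rfl⟩
  rw [G.expec_mul_right _ (G.jay_fixed hδ (hDJ hd))]
  exact (G.fixed_mul_ideal hδ hDc hDJ hid (G.expec_mem x) hd).1

lemma jay_simple (G : MaxGap α lam) (hδ0 : 0 < δ) (hδ : δ < lam) (hDc : IsClosed (D : Set X))
    (hDJ : D ≤ jay α lam δ) (hid : ∀ s ∈ jay α lam δ, ∀ d ∈ D, s * d ∈ D ∧ d * s ∈ D)
    (hne : ∃ d ∈ D, d ≠ 0) : D = jay α lam δ :=
  le_antisymm hDJ (G.jay_simple_aux hδ0 hδ hDc hDJ hid hne).2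

lemma neg_subset (G : MaxGap α lam) (hδ0 : 0 < δ) (hδ : δ < lam) :
    specC α (Iic (-lam)) ⊆ cmul univ (jay α lam δ : Set X) :=
  (G.jay_simple_aux hδ0 hδ (isClosed_jay _ _) le_rfl (fun _ hs _ hd =>
    ⟨G.fixed_mul_jay (G.jay_fixed hδ hs) hd, G.fixed_mul_jay (G.jay_fixed hδ hd) hs⟩)
    (G.jay_ne hδ0)).1

lemma pos_subset (G : MaxGap α lam) (hδ0 : 0 < δ) (hδ : δ < lam) :
    specC α (Ici lam) ⊆ cmul (jay α lam δ : Set X) univ := by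
  intro x hx
  have h1 : star x ∈ specC α (Iic (-lam)) :=
    G.sys.star_mem_specC' (fun γ hγ => by simpa using hγ) hx
  have := star_mem_cmul (S' := univ) (T' := (jay α lam δ : Set X)) (fun _ _ => mem_univ _)
    (fun _ ht => G.jay_star ht) (G.neg_subset hδ0 hδ h1)
  simpa using this

end MaxGap

end MaxGapSection

/-! ### The spectrum is contained in a lattice -/

section LatticeSection

variable {α : ℝ → X → X} {lam : ℝ}

/-- The spectral subspace of the `k`-th multiple of `lam`. -/
def layer (α : ℝ → X → X) (lam : ℝ) (k : ℤ) : Set X := specC α {k * lam}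

lemma layer_reverse (k : ℤ) : layer (fun t => α (-t)) lam k = layer α lam (-k) := by
  rw [layer, layer, specC_reverse]
  simp

lemma layer_subset (α : ℝ → X → X) {F : Set ℝ} {k : ℤ} (h : (k * lam : ℝ) ∈ F) :
    layer α lam k ⊆ specC α F := fun _ hx =>
  specC_mono (by simpa using h) hx

/-- The ideal of the fixed-point algebra spanned by the products `x * star y` of elements of the
first layer. -/
def upIdeal (α : ℝ → X → X) (lam : ℝ) : Submodule ℂ X :=
  cmul (layer α lam 1) (layer α lam (-1))

lemma upIdeal_reverse : upIdeal (fun t => α (-t)) lam =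
    cmul (layer α lam (-1)) (layer α lam 1) := by
  rw [upIdeal, layer_reverse, layer_reverse, neg_neg]

lemma isClosed_upIdeal : IsClosed (upIdeal α lam : Set X) := isClosed_cmul _ _

namespace MaxGap

lemma eq_zero_of_mem_between (G : MaxGap α lam) (n : ℕ) : ∀ {a b : ℝ} {z : X}, n * lam < a →
    b < (n + 1) * lam → z ∈ specC α (Icc a b) → z = 0 := by
  have hlam := G.pos
  induction n with
  | zero =>
    intro a b z ha hb hz
    refine G.sys.eq_zero_of_elemSpec_eq_empty (subset_empty_iff.mp ?_)
    refine G.mem_specC hz fun γ hγ h => ?_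
    have h1 := hγ.1
    have h2 := hγ.2
    simp only [Nat.cast_zero, zero_mul, zero_add, one_mul] at ha hb
    rcases h with h | h | h <;> linarith
  | succ n ih =>
    intro a b z ha hb hz
    push_cast at ha hb
    obtain ⟨δ, hδ0, hδ⟩ := exists_between (lt_min hlam (sub_pos.mpr ha))
    have hδ1 := hδ.trans_le (min_le_left _ _)
    have hδ2 := hδ.trans_le (min_le_right _ _)
    have hn : (0 : ℝ) ≤ n * lam := by positivity
    have hz' : z ∈ specC α (Ici lam) :=
      specC_mono (fun γ hγ => by rw [mem_Ici]; linarith [hγ.1]) hz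
    have h0 : z ∈ ((⊥ : Submodule ℂ X) : Set X) := by
      refine mem_of_mul_mem_left (isClosed_jay lam δ) (G.isStarSubalgebra_jay hδ1)
        (G.pos_subset hδ0 hδ1 hz') (by simp) fun e he => ?_
      refine mul_mem_of_mem_cspan_left (by simp) ?_ he
      rintro _ ⟨s, -, t, ht, rfl⟩
      have h1 : t * z ∈ specC α (Icc (a - lam - δ) (b - lam)) :=
        G.sys.mul_mem_specC isClosed_Icc isClosed_Icc
          (fun p hp q hq => ⟨by linarith [hp.1, hq.1], by linarith [hp.2, hq.2]⟩) ht hz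
      rw [mul_assoc, ih (by linarith) (by linarith) h1, mul_zero]
      exact Submodule.zero_mem _
    simpa using h0

lemma pos_lattice (G : MaxGap α lam) {γ : ℝ} (hγ0 : 0 < γ) {x : X} (hγ : γ ∈ elemSpec α x) :
    ∃ k : ℤ, γ = k * lam := by
  have hlam := G.pos
  set n := ⌊γ / lam⌋₊ with hn
  have h1 : n * lam ≤ γ := by
    rw [← le_div_iff₀ hlam]
    exact Nat.floor_le (by positivity)
  have h2 : γ < (n + 1) * lam := by
    rw [← div_lt_iff₀ hlam]
    exact Nat.lt_floor_add_one _
  rcases h1.eq_or_lt with h1 | h1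
  · exact ⟨n, by simp [h1]⟩
  obtain ⟨ε, hε0, hε⟩ := exists_between (lt_min (sub_pos.mpr h1) (sub_pos.mpr h2))
  have hε1 := hε.trans_le (min_le_left _ _)
  have hε2 := hε.trans_le (min_le_right _ _)
  refine absurd ?_ (G.sys.elemSpec_subset_actSpec x hγ ε hε0)
  rw [univ_inter]
  ext z
  rw [mem_singleton_iff]
  refine ⟨fun hz => G.eq_zero_of_mem_between n (by linarith) (by linarith) hz, ?_⟩
  rintro rfl
  exact (G.sys.specM isClosed_Icc).zero_mem

lemma lattice (G : MaxGap α lam) {γ : ℝ} {x : X} (hγ : γ ∈ elemSpec α x) :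
    ∃ k : ℤ, γ = k * lam := by
  rcases lt_trichotomy γ 0 with h | h | h
  · have h1 : -γ ∈ elemSpec (fun t => α (-t)) x := by
      rw [elemSpec_reverse]; simpa using hγ
    obtain ⟨k, hk⟩ := G.reverse.pos_lattice (by linarith) h1
    exact ⟨-k, by push_cast; linarith⟩
  · exact ⟨0, by simp [h]⟩
  · exact G.pos_lattice h hγ

lemma mem_specC_of_lattice (G : MaxGap α lam) {F F' : Set ℝ} {x : X} (hx : x ∈ specC α F)
    (h : ∀ k : ℤ, k * lam ∈ F → k * lam ∈ F') : x ∈ specC α F' := by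
  intro γ hγ
  obtain ⟨k, rfl⟩ := G.lattice hγ
  exact h k (hx hγ)

lemma mem_layer_of_near (G : MaxGap α lam) {F : Set ℝ} {k : ℤ} {x : X} (hx : x ∈ specC α F)
    (h : ∀ γ ∈ F, (k - 1) * lam < γ ∧ γ < (k + 1) * lam) : x ∈ layer α lam k := by
  have hlam := G.pos
  refine G.mem_specC_of_lattice hx fun m hm => ?_
  obtain ⟨h1, h2⟩ := h _ hm
  rw [mul_lt_mul_iff_left₀ hlam] at h1 h2
  have h1' : k - 1 < m := by exact_mod_cast h1
  have h2' : m < k + 1 := by exact_mod_cast h2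
  rw [show m = k by lia]
  rfl

lemma layer_mul (G : MaxGap α lam) {k m n : ℤ} (h : k + m = n) {x y : X}
    (hx : x ∈ layer α lam k) (hy : y ∈ layer α lam m) : x * y ∈ layer α lam n :=
  G.sys.mul_mem_specC isClosed_singleton isClosed_singleton (fun a ha b hb => by
    rw [mem_singleton_iff] at *
    rw [ha, hb, ← h]
    push_cast
    ring) hx hy

lemma star_layer (G : MaxGap α lam) {k m : ℤ} (h : -k = m) {x : X} (hx : x ∈ layer α lam k) :
    star x ∈ layer α lam m :=
  G.sys.star_mem_specC' (fun γ hγ => by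
    rw [mem_singleton_iff] at *
    rw [hγ, ← h]
    push_cast
    ring) hx

lemma layer_zero (G : MaxGap α lam) : layer α lam 0 = fixedPts α := by
  rw [layer, Int.cast_zero, zero_mul, G.sys.specC_zero]

lemma upIdeal_eq_jay (G : MaxGap α lam) : upIdeal α lam = jay α lam (lam / 2) := by
  have hlam := G.pos
  refine le_antisymm (cmul_mono (layer_subset α ?_) (layer_subset α ?_))
    (cmul_mono (fun x hx => G.mem_layer_of_near hx ?_) (fun x hx => G.mem_layer_of_near hx ?_))
  · constructor <;> push_cast <;> linarith
  · constructor <;> push_cast <;> linarith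
  · intro γ hγ
    constructor <;> push_cast <;> linarith [hγ.1, hγ.2]
  · intro γ hγ
    constructor <;> push_cast <;> linarith [hγ.1, hγ.2]

lemma isStarSubalgebra_upIdeal (G : MaxGap α lam) :
    IsStarSubalgebra (upIdeal α lam : Set X) := by
  rw [G.upIdeal_eq_jay]
  exact G.isStarSubalgebra_jay (by linarith [G.pos])

lemma upIdeal_fixed (G : MaxGap α lam) {x : X} (hx : x ∈ upIdeal α lam) : x ∈ fixedPts α := by
  rw [G.upIdeal_eq_jay] at hx
  exact G.jay_fixed (by linarith [G.pos]) hx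

lemma fixed_mul_upIdeal (G : MaxGap α lam) {d x : X} (hd : d ∈ fixedPts α)
    (hx : x ∈ upIdeal α lam) : d * x ∈ upIdeal α lam := by
  rw [G.upIdeal_eq_jay] at *
  exact G.fixed_mul_jay hd hx

lemma upIdeal_mul_fixed (G : MaxGap α lam) {d x : X} (hd : d ∈ fixedPts α)
    (hx : x ∈ upIdeal α lam) : x * d ∈ upIdeal α lam := by
  rw [G.upIdeal_eq_jay] at *
  exact G.jay_mul_fixed hd hx

lemma upIdeal_simple (G : MaxGap α lam) {D : Submodule ℂ X} (hDc : IsClosed (D : Set X))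
    (hDJ : D ≤ upIdeal α lam)
    (hid : ∀ s ∈ upIdeal α lam, ∀ d ∈ D, s * d ∈ D ∧ d * s ∈ D)
    (hne : ∃ d ∈ D, d ≠ 0) : D = upIdeal α lam := by
  rw [G.upIdeal_eq_jay] at *
  exact G.jay_simple (half_pos G.pos) (by linarith [G.pos]) hDc hDJ hid hne

lemma upIdeal_ne (G : MaxGap α lam) : ∃ x ∈ upIdeal α lam, x ≠ 0 := by
  rw [G.upIdeal_eq_jay]
  exact G.jay_ne (half_pos G.pos)

lemma pos_subset_upIdeal (G : MaxGap α lam) :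
    specC α (Ici lam) ⊆ cmul (upIdeal α lam : Set X) univ := by
  rw [G.upIdeal_eq_jay]
  exact G.pos_subset (half_pos G.pos) (by linarith [G.pos])

/-- Either the two one-sided ideals coincide, or they annihilate each other. -/
lemma eq_or_annihilate (G : MaxGap α lam) :
    upIdeal (fun t => α (-t)) lam = upIdeal α lam ∨
      ∀ x ∈ upIdeal α lam, ∀ y ∈ upIdeal (fun t => α (-t)) lam, x * y = 0 := by
  have hrf : fixedPts (fun t => α (-t)) = fixedPts α := by
    ext x
    refine ⟨fun h t => by simpa using h (-t), fun h t => h (-t)⟩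
  set D := upIdeal α lam ⊓ upIdeal (fun t => α (-t)) lam with hD
  have hDc : IsClosed (D : Set X) := by
    rw [hD, Submodule.coe_inf]
    exact isClosed_upIdeal.inter isClosed_upIdeal
  have hid : ∀ s ∈ fixedPts α, ∀ d ∈ D, s * d ∈ D ∧ d * s ∈ D := fun s hs d hd =>
    ⟨⟨G.fixed_mul_upIdeal hs hd.1, G.reverse.fixed_mul_upIdeal (by rwa [hrf]) hd.2⟩,
      ⟨G.upIdeal_mul_fixed hs hd.1, G.reverse.upIdeal_mul_fixed (by rwa [hrf]) hd.2⟩⟩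
  by_cases hne : ∃ d ∈ D, d ≠ 0
  · left
    have h1 := G.upIdeal_simple hDc inf_le_left (fun s hs => hid s (G.upIdeal_fixed hs)) hne
    have h2 := G.reverse.upIdeal_simple hDc inf_le_right
      (fun s hs => hid s (by rw [← hrf]; exact G.reverse.upIdeal_fixed hs)) hne
    rw [← h1, ← h2]
  · right
    push Not at hne
    intro x hx y hy
    have hyf : y ∈ fixedPts α := by rw [← hrf]; exact G.reverse.upIdeal_fixed hy
    exact hne _ ⟨G.upIdeal_mul_fixed hyf hx,
      G.reverse.fixed_mul_upIdeal (by rw [hrf]; exact G.upIdeal_fixed hx) hy⟩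

/-- In the annihilating case there is no spectrum beyond the first layer. -/
lemma layer_eq_zero_of_annihilate (G : MaxGap α lam)
    (h : ∀ x ∈ upIdeal α lam, ∀ y ∈ upIdeal (fun t => α (-t)) lam, x * y = 0)
    {k : ℤ} (hk : 2 ≤ k) {z : X} (hz : z ∈ layer α lam k) : z = 0 := by
  have hlam := G.pos
  have hmem : ∀ {m : ℤ} {x : X}, 1 ≤ m → x ∈ layer α lam m →
      x ∈ cmul (upIdeal α lam : Set X) univ := fun {m x} hm hx => by
    refine G.pos_subset_upIdeal (layer_subset α ?_ hx)
    have : (1 : ℝ) ≤ m := by exact_mod_cast hm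
    rw [mem_Ici]
    nlinarith
  have h0 : ∀ {m : ℤ} {x : X}, 1 ≤ m → x ∈ layer α lam m → (∀ e ∈ upIdeal α lam, e * x = 0) →
      x = 0 := fun {m x} hm hx he => by
    have h1 : x ∈ ((⊥ : Submodule ℂ X) : Set X) :=
      mem_of_mul_mem_left isClosed_upIdeal G.isStarSubalgebra_upIdeal (hmem hm hx) (by simp)
        fun e he' => by simpa using he e he'
    simpa using h1
  refine h0 (by lia) hz fun e he => ?_
  have h1 : e * z ∈ (⊥ : Submodule ℂ X) := by
    refine mul_mem_of_mem_cspan_left (by simp) ?_ he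
    rintro _ ⟨s, -, t, ht, rfl⟩
    rw [mul_assoc, h0 (m := k - 1) (by lia) (G.layer_mul (by lia) ht hz), mul_zero]
    · exact Submodule.zero_mem _
    intro e' he'
    have h2 : e' * t = 0 := by
      rw [← CStarRing.mul_star_self_eq_zero_iff, star_mul, mul_assoc, ← mul_assoc t,
        ← mul_assoc e', h e' he', zero_mul]
      rw [upIdeal_reverse]
      exact mul_mem_cmul ht (G.star_layer (by lia) ht)
    rw [← mul_assoc, h2, zero_mul]
  simpa using h1

end MaxGap

end LatticeSection

/-! ### The case of a single layer -/

section SingleLayer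

variable {α : ℝ → X → X} {lam : ℝ}

lemma mem_actSpec_of_layer {S : Set X} {k : ℤ} {x : X} (hxS : x ∈ S)
    (hx : x ∈ layer α lam k) (hx0 : x ≠ 0) : (k * lam : ℝ) ∈ actSpec α S := by
  intro ε hε h
  have : x ∈ ({0} : Set X) := by
    rw [← h]
    exact ⟨hxS, layer_subset α (by constructor <;> linarith) hx⟩
  exact hx0 this

namespace MaxGap

lemma exists_layer_of_mem_actSpec (G : MaxGap α lam) {S : Set X} (h0 : (0 : X) ∈ S) {γ : ℝ}
    (hγ : γ ∈ actSpec α S) :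
    ∃ k : ℤ, γ = k * lam ∧ ∃ x ∈ S, x ∈ layer α lam k ∧ x ≠ 0 := by
  have hlam := G.pos
  have hex : ∀ ε > 0, ∃ x ∈ S, x ∈ specC α (Icc (γ - ε) (γ + ε)) ∧ x ≠ 0 := by
    intro ε hε
    by_contra hcon
    push Not at hcon
    refine hγ ε hε (Subset.antisymm (fun x hx => hcon x hx.1 hx.2) ?_)
    rintro _ rfl
    exact ⟨h0, (G.sys.specM isClosed_Icc).zero_mem⟩
  set k : ℤ := round (γ / lam) with hk
  have hkγ : |γ - k * lam| ≤ lam / 2 := by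
    have h1 := abs_sub_round (γ / lam)
    rw [← hk] at h1
    have h2 : γ - k * lam = (γ / lam - k) * lam := by field_simp
    rw [h2, abs_mul, abs_of_pos hlam]
    nlinarith
  have hclose : ∀ ε > 0, ε ≤ lam / 4 → |γ - k * lam| ≤ ε := by
    intro ε hε hε'
    obtain ⟨x, -, hx, hx0⟩ := hex ε hε
    obtain ⟨μ, hμ⟩ : (elemSpec α x).Nonempty := by
      rw [nonempty_iff_ne_empty]
      exact fun h => hx0 (G.sys.eq_zero_of_elemSpec_eq_empty h)
    obtain ⟨m, rfl⟩ := G.lattice hμ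
    have h1 := hx hμ
    rw [abs_le] at hkγ ⊢
    have h2 : ((m : ℝ) - 1) * lam < k * lam := by linarith [h1.1, h1.2, hkγ.1, hkγ.2]
    have h3 : (k : ℝ) * lam < (m + 1) * lam := by linarith [h1.1, h1.2, hkγ.1, hkγ.2]
    rw [mul_lt_mul_iff_left₀ hlam] at h2 h3
    have h2' : m - 1 < k := by exact_mod_cast h2
    have h3' : k < m + 1 := by exact_mod_cast h3
    rw [show k = m by lia]
    constructor <;> linarith [h1.1, h1.2]
  have heq : γ = k * lam := by
    by_contra hne
    have hpos : 0 < |γ - k * lam| := abs_pos.mpr (sub_ne_zero.mpr hne)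
    have := hclose (min (|γ - k * lam| / 2) (lam / 4)) (lt_min (half_pos hpos) (by linarith))
      (min_le_right _ _)
    linarith [this.trans (min_le_left _ _)]
  obtain ⟨x, hxS, hx, hx0⟩ := hex (lam / 4) (by linarith)
  refine ⟨k, heq, x, hxS, G.mem_layer_of_near hx fun μ hμ => ?_, hx0⟩
  rw [heq] at hμ
  constructor <;> linarith [hμ.1, hμ.2]

lemma exists_ne_zero_layer_one (G : MaxGap α lam) : ∃ x ∈ layer α lam 1, x ≠ 0 := by
  have hlam := G.pos
  obtain ⟨x, hx, hx0⟩ := G.bottom (lam / 2) (half_pos hlam)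
  refine ⟨x, G.mem_layer_of_near hx fun γ hγ => ?_, hx0⟩
  constructor <;> push_cast <;> linarith [hγ.1, hγ.2]

lemma condition_of_annihilate (G : MaxGap α lam)
    (h : ∀ x ∈ upIdeal α lam, ∀ y ∈ upIdeal (fun t => α (-t)) lam, x * y = 0)
    (h0 : (0 : ℝ) ∈ actSpec α (univ : Set X)) : Condition43 α := by
  have hlam := G.pos
  have hl1 : specC α {lam} = layer α lam 1 := by simp [layer]
  have hl2 : star '' layer α lam 1 = layer α lam (-1) := by
    ext x
    constructor
    · rintro ⟨y, hy, rfl⟩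
      exact G.star_layer rfl hy
    · exact fun hx => ⟨star x, G.star_layer (by simp) hx, star_star x⟩
  have hJ : ClosedSpan (MulSet2 (specC α ({lam} : Set ℝ)) (star '' specC α ({lam} : Set ℝ))) =
      (upIdeal α lam : Set X) := by
    rw [hl1, hl2]
    rfl
  refine Or.inl ⟨lam, hlam, ?_, ?_, ?_⟩
  · obtain ⟨y, hy, hy0⟩ := G.exists_ne_zero_layer_one
    refine Subset.antisymm (fun γ hγ => ?_) ?_
    · obtain ⟨k, rfl, x, -, hx, hx0⟩ := G.exists_layer_of_mem_actSpec (mem_univ _) hγ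
      have h1 : k < 2 := by
        by_contra hk
        exact hx0 (G.layer_eq_zero_of_annihilate h (not_lt.mp hk) hx)
      have h2 : -2 < k := by
        by_contra hk
        refine hx0 (star_eq_zero.mp (G.layer_eq_zero_of_annihilate h (k := -k) (by lia) ?_))
        exact G.star_layer rfl hx
      obtain rfl | rfl | rfl : k = -1 ∨ k = 0 ∨ k = 1 := by lia
      all_goals simp
    · rintro γ (rfl | rfl | rfl)
      · have := mem_actSpec_of_layer (mem_univ _) (G.star_layer rfl hy) (star_ne_zero.mpr hy0)
        simpa using this
      · exact h0
      · simpa using mem_actSpec_of_layer (mem_univ _) hy hy0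
  · rw [hJ]
    exact ⟨fun x hx => G.upIdeal_fixed hx, isClosed_upIdeal, Submodule.zero_mem _,
      fun x hx y hy => Submodule.add_mem _ hx hy, fun c x hx => Submodule.smul_mem _ c hx,
      fun s hs k hk => ⟨G.fixed_mul_upIdeal hs hk, G.upIdeal_mul_fixed hs hk⟩⟩
  · rw [hJ]
    rintro K ⟨hKJ, hKc, hK0, hKadd, hKsmul, hKmul⟩
    let D : Submodule ℂ X :=
      { carrier := K
        zero_mem' := hK0
        add_mem' := fun {a b} ha hb => hKadd a ha b hb
        smul_mem' := fun c x hx => hKsmul c x hx }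
    by_cases hne : ∃ d ∈ D, d ≠ 0
    · right
      have := G.upIdeal_simple (D := D) hKc hKJ hKmul hne
      exact congrArg (fun M : Submodule ℂ X => (M : Set X)) this
    · left
      push Not at hne
      refine Subset.antisymm hne ?_
      rintro _ rfl
      exact hK0

end MaxGap

end SingleLayer

/-! ### Gaps from isolated points of the spectrum -/

lemma exists_ne_zero_of_mem_actSpec {α : ℝ → X → X} (hα : IsCStarDynSys α) {γ : ℝ}
    (hγ : γ ∈ actSpec α (univ : Set X)) {ε : ℝ} (hε : 0 < ε) :
    ∃ x ∈ specC α (Icc (γ - ε) (γ + ε)), x ≠ 0 := by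
  by_contra hcon
  push Not at hcon
  refine hγ ε hε (Subset.antisymm (fun x hx => hcon x hx.2) ?_)
  rintro _ rfl
  exact ⟨mem_univ _, (hα.specM isClosed_Icc).zero_mem⟩

lemma neg_mem_actSpec {α : ℝ → X → X} (hα : IsCStarDynSys α) {γ : ℝ}
    (hγ : γ ∈ actSpec α (univ : Set X)) : -γ ∈ actSpec α (univ : Set X) := by
  intro ε hε h
  obtain ⟨x, hx, hx0⟩ := exists_ne_zero_of_mem_actSpec hα hγ hε
  have : star x ∈ ({0} : Set X) := by
    rw [← h]
    refine ⟨mem_univ _, hα.star_mem_specC' (F := Icc (γ - ε) (γ + ε)) (fun μ hμ => ?_) hx⟩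
    constructor <;> linarith [hμ.1, hμ.2]
  exact hx0 (star_eq_zero.mp this)

lemma exists_maxGap {α : ℝ → X → X} (hα : IsCStarDynSys α)
    (hnontrivial : actSpec α (univ : Set X) ≠ ({0} : Set ℝ))
    (hmax : IsMaximalClosedSubalgebra (specC α (Ici (0 : ℝ))))
    (h0mem : (0 : ℝ) ∈ actSpec α (univ : Set X))
    (h0iso : ∃ ε > (0 : ℝ), actSpec α (univ : Set X) ∩ Ioo (-ε) ε = ({0} : Set ℝ)) :
    ∃ lam, MaxGap α lam := by
  obtain ⟨ε, hε, hiso⟩ := h0iso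
  set P := actSpec α (univ : Set X) ∩ Ioi 0 with hP
  have hbdd : ∀ γ ∈ P, ε ≤ γ := by
    rintro γ ⟨hγ, hγ0⟩
    by_contra hlt
    have : γ ∈ ({0} : Set ℝ) := by
      rw [← hiso]
      exact ⟨hγ, by linarith [mem_Ioi.mp hγ0], not_le.mp hlt⟩
    exact (ne_of_gt hγ0) this
  have hne : P.Nonempty := by
    by_contra hcon
    rw [not_nonempty_iff_eq_empty] at hcon
    refine hnontrivial (Subset.antisymm (fun γ hγ => ?_) (by simpa using h0mem))
    by_contra h0
    rcases lt_or_gt_of_ne (show γ ≠ 0 from h0) with h | h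
    · have : -γ ∈ P := ⟨neg_mem_actSpec hα hγ, by rw [mem_Ioi]; linarith⟩
      rw [hcon] at this
      exact this
    · have : γ ∈ P := ⟨hγ, h⟩
      rw [hcon] at this
      exact this
  have hbb : BddBelow P := ⟨ε, hbdd⟩
  refine ⟨sInf P, ⟨⟨hα, hε.trans_le (le_csInf hne hbdd), fun x γ hγ => ?_⟩, hmax.2.2.2, ?_⟩⟩
  · have h1 := hα.elemSpec_subset_actSpec x hγ
    rcases lt_trichotomy γ 0 with h | h | h
    · left; left
      have := csInf_le hbb (show -γ ∈ P from ⟨neg_mem_actSpec hα h1, by rw [mem_Ioi]; linarith⟩)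
      rw [mem_Iic]
      linarith
    · left; right; exact h
    · right
      exact csInf_le hbb ⟨h1, h⟩
  · intro δ hδ
    set δ' := min δ (sInf P) with hδ'
    have hδ'0 : 0 < δ' := lt_min hδ (hε.trans_le (le_csInf hne hbdd))
    obtain ⟨γ, hγ, hlt⟩ := exists_lt_of_csInf_lt hne (lt_add_of_pos_right (sInf P) (half_pos hδ'0))
    have hge := csInf_le hbb hγ
    obtain ⟨x, hx, hx0⟩ := exists_ne_zero_of_mem_actSpec hα hγ.1 (half_pos hδ'0)
    refine ⟨x, fun μ hμ => ?_, hx0⟩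
    have h1 := hx hμ
    have h2 := hα.elemSpec_subset_actSpec x hμ
    have h3 : δ' ≤ sInf P := min_le_right _ _
    have h4 : δ' ≤ δ := min_le_left _ _
    exact ⟨csInf_le hbb ⟨h2, by rw [mem_Ioi]; linarith [h1.1]⟩, by linarith [h1.2]⟩

/-! ### The ideal generated by the first layer -/

section FullIdeal

variable {α : ℝ → X → X} {lam : ℝ}

/-- The closed right ideal generated by `upIdeal`. -/
def bigIdeal (α : ℝ → X → X) (lam : ℝ) : Submodule ℂ X := cmul (upIdeal α lam : Set X) univ

lemma isClosed_bigIdeal : IsClosed (bigIdeal α lam : Set X) := isClosed_cmul _ _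

lemma bigIdeal_mul {x : X} (hx : x ∈ bigIdeal α lam) (y : X) : x * y ∈ bigIdeal α lam := by
  refine mul_mem_of_mem_cspan_left isClosed_bigIdeal ?_ hx
  rintro _ ⟨s, hs, t, -, rfl⟩
  rw [mul_assoc]
  exact mul_mem_cmul hs (mem_univ _)

namespace MaxGap

lemma bigIdeal_invariant (G : MaxGap α lam) : Invariant α (bigIdeal α lam : Set X) := by
  intro t x hx
  refine map_mem_of_mem_cspan isClosed_bigIdeal (G.sys.clm t) ?_ hx
  rintro _ ⟨s, hs, y, -, rfl⟩
  change α t (s * y) ∈ _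
  rw [G.sys.map_mul, G.upIdeal_fixed hs t]
  exact mul_mem_cmul hs (mem_univ _)

lemma upIdeal_le_bigIdeal (G : MaxGap α lam) : upIdeal α lam ≤ bigIdeal α lam := fun _ hx =>
  cmul_mono le_rfl (subset_univ _)
    (mem_cmul_self isClosed_upIdeal G.isStarSubalgebra_upIdeal hx)

lemma pos_subset_bigIdeal (G : MaxGap α lam) : specC α (Ici lam) ⊆ bigIdeal α lam :=
  G.pos_subset_upIdeal

lemma mem_upIdeal_of_fixed (G : MaxGap α lam) {x : X} (hx : x ∈ bigIdeal α lam)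
    (hf : x ∈ fixedPts α) : x ∈ upIdeal α lam := by
  rw [← G.expec_fixed hf]
  refine map_mem_of_mem_cspan isClosed_upIdeal G.expec ?_ hx
  rintro _ ⟨s, hs, y, -, rfl⟩
  rw [G.expec_mul_left _ (G.upIdeal_fixed hs)]
  exact G.upIdeal_mul_fixed (G.expec_mem y) hs

lemma neg_subset_bigIdeal (G : MaxGap α lam)
    (hJ : upIdeal (fun t => α (-t)) lam = upIdeal α lam) : specC α (Iic (-lam)) ⊆ bigIdeal α lam := by
  have h := G.reverse.pos_subset_bigIdeal
  rw [specC_reverse, bigIdeal, hJ] at h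
  rw [bigIdeal]
  simpa using h

lemma mul_upIdeal_mem (G : MaxGap α lam)
    (hJ : upIdeal (fun t => α (-t)) lam = upIdeal α lam) (x : X) {j : X} (hj : j ∈ upIdeal α lam) :
    x * j ∈ bigIdeal α lam := by
  let N : Submodule ℂ X := (bigIdeal α lam).comap
    ((ContinuousLinearMap.mul ℂ X).flip j : X →ₗ[ℂ] X)
  have hN : IsClosed (N : Set X) :=
    isClosed_bigIdeal.preimage ((ContinuousLinearMap.mul ℂ X).flip j).continuous
  exact G.mem_of_forall (N := N) hN
    (fun y hy => bigIdeal_mul (G.neg_subset_bigIdeal hJ hy) j)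
    (fun y hy => G.upIdeal_le_bigIdeal (G.fixed_mul_upIdeal hy hj))
    (fun y hy => bigIdeal_mul (G.pos_subset_bigIdeal hy) j) x

lemma mul_bigIdeal (G : MaxGap α lam)
    (hJ : upIdeal (fun t => α (-t)) lam = upIdeal α lam) (x : X) {y : X} (hy : y ∈ bigIdeal α lam) :
    x * y ∈ bigIdeal α lam := by
  refine mul_mem_of_mem_cspan_right isClosed_bigIdeal ?_ hy
  rintro _ ⟨s, hs, t, -, rfl⟩
  rw [← mul_assoc]
  exact bigIdeal_mul (G.mul_upIdeal_mem hJ x hs) t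

lemma star_bigIdeal (G : MaxGap α lam)
    (hJ : upIdeal (fun t => α (-t)) lam = upIdeal α lam) {y : X} (hy : y ∈ bigIdeal α lam) :
    star y ∈ bigIdeal α lam := by
  refine star_mem_of_mem_cspan isClosed_bigIdeal ?_ hy
  rintro _ ⟨s, hs, t, -, rfl⟩
  rw [star_mul]
  exact G.mul_upIdeal_mem hJ _ (G.isStarSubalgebra_upIdeal.2 s hs)

lemma isStarSubalgebra_bigIdeal (G : MaxGap α lam)
    (hJ : upIdeal (fun t => α (-t)) lam = upIdeal α lam) :
    IsStarSubalgebra (bigIdeal α lam : Set X) :=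
  ⟨⟨Submodule.zero_mem _, fun _ hx _ hy => Submodule.add_mem _ hx hy,
    fun c _ hx => Submodule.smul_mem _ c hx, fun _ hx y _ => bigIdeal_mul hx y⟩,
    fun _ hx => G.star_bigIdeal hJ hx⟩

lemma isIdeal_bigIdeal (G : MaxGap α lam)
    (hJ : upIdeal (fun t => α (-t)) lam = upIdeal α lam) :
    IsClosedTwoSidedIdealIn univ (bigIdeal α lam : Set X) :=
  ⟨subset_univ _, isClosed_bigIdeal, Submodule.zero_mem _,
    fun _ hx _ hy => Submodule.add_mem _ hx hy, fun c _ hx => Submodule.smul_mem _ c hx,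
    fun s _ _ hk => ⟨G.mul_bigIdeal hJ s hk, bigIdeal_mul hk s⟩⟩

/-- Nonzero invariant star-subalgebras contain nonzero fixed points. -/
lemma exists_fixed_ne_zero (G : MaxGap α lam) {B : Submodule ℂ X} (hc : IsClosed (B : Set X))
    (hB : IsStarSubalgebra (B : Set X)) (hinv : Invariant α (B : Set X))
    (hne : ∃ b ∈ B, b ≠ 0) : ∃ c ∈ B, c ∈ fixedPts α ∧ c ≠ 0 := by
  obtain ⟨b, hb, hb0⟩ := hne
  by_contra hcon
  push Not at hcon
  have h : b ∈ ((⊥ : Submodule ℂ X) : Set X) :=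
    G.mem_of_fixed_mul_mem hc hB hinv hb (by simp) fun c hc hf => by simp [hcon c hc hf]
  exact hb0 (by simpa using h)

lemma alphaSimple_bigIdeal (G : MaxGap α lam)
    (hJ : upIdeal (fun t => α (-t)) lam = upIdeal α lam) : AlphaSimple α (bigIdeal α lam : Set X) := by
  rintro K ⟨hKY, hKc, hK0, hKadd, hKsmul, hKmul⟩ hKinv
  by_cases hne : ∃ k ∈ K, k ≠ 0
  swap
  · left
    push Not at hne
    refine Subset.antisymm hne ?_
    rintro _ rfl
    exact hK0
  right
  obtain ⟨k, hk, hk0⟩ := hne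
  let D : Submodule ℂ X :=
    { carrier := K
      zero_mem' := hK0
      add_mem' := fun {a b} ha hb => hKadd a ha b hb
      smul_mem' := fun c x hx => hKsmul c x hx }
  let B : Submodule ℂ X :=
    { carrier := {x | x ∈ K ∧ star x ∈ K}
      zero_mem' := by simpa using hK0
      add_mem' := fun {a b} ha hb =>
        ⟨hKadd a ha.1 b hb.1, by simpa using hKadd _ ha.2 _ hb.2⟩
      smul_mem' := fun c x hx => ⟨hKsmul c x hx.1, by simpa using hKsmul (star c) _ hx.2⟩ }
  have hBc : IsClosed (B : Set X) := hKc.inter (hKc.preimage continuous_star)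
  have hBs : IsStarSubalgebra (B : Set X) := by
    refine ⟨⟨B.zero_mem, fun _ hx _ hy => B.add_mem hx hy, fun c _ hx => B.smul_mem c hx,
      fun x hx y hy => ⟨(hKmul x (hKY hx.1) y hy.1).1, ?_⟩⟩, fun x hx => ⟨hx.2, ?_⟩⟩
    · rw [star_mul]
      exact (hKmul _ (hKY hy.2) _ hx.2).1
    · rw [star_star]
      exact hx.1
  have hBi : Invariant α (B : Set X) := fun t x hx =>
    ⟨hKinv t x hx.1, by rw [← G.sys.map_star]; exact hKinv t _ hx.2⟩
  have hkk : star k * k ∈ K := (hKmul _ (G.star_bigIdeal hJ (hKY hk)) k hk).1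
  obtain ⟨c, hcB, hcf, hc0⟩ := G.exists_fixed_ne_zero hBc hBs hBi
    ⟨star k * k, ⟨hkk, by simpa using hkk⟩, by
      rwa [Ne, CStarRing.star_mul_self_eq_zero_iff]⟩
  have hJK : upIdeal α lam ≤ D := by
    rw [← G.upIdeal_simple (D := D ⊓ upIdeal α lam) ?_ inf_le_right ?_ ?_]
    · exact inf_le_left
    · rw [Submodule.coe_inf]
      exact hKc.inter isClosed_upIdeal
    · intro s hs d hd
      have h1 := hKmul s (G.upIdeal_le_bigIdeal hs) d hd.1
      exact ⟨⟨h1.1, G.fixed_mul_upIdeal (G.upIdeal_fixed hs) hd.2⟩,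
        ⟨h1.2, G.upIdeal_mul_fixed (G.upIdeal_fixed hs) hd.2⟩⟩
    · exact ⟨c, ⟨hcB.1, G.mem_upIdeal_of_fixed (hKY hcB.1) hcf⟩, hc0⟩
  refine Subset.antisymm hKY ?_
  refine cmul_le (M := D) hKc fun j hj x _ => ?_
  refine mul_mem_of_mem_cspan_left hKc ?_
    (mem_cmul_self isClosed_upIdeal G.isStarSubalgebra_upIdeal hj)
  rintro _ ⟨j₁, h₁, j₂, h₂, rfl⟩
  rw [mul_assoc]
  exact (hKmul _ (bigIdeal_mul (G.upIdeal_le_bigIdeal h₂) x) _ (hJK h₁)).2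

lemma specO_bigIdeal (G : MaxGap α lam) :
    specO α (bigIdeal α lam : Set X) (Ioi 0) = specO α univ (Ioi 0) := by
  refine Subset.antisymm (cspan_mono ?_) (cspan_mono ?_)
  · rintro y ⟨x, -, h⟩
    exact ⟨x, mem_univ _, h⟩
  · rintro y ⟨x, -, f, hf, hK, hsub, rfl⟩
    obtain ⟨φ, hφ, h1, hs⟩ := exists_test hK isOpen_Ioi hsub
    have hsp := G.sys.elemSpec_smear_subset_tsupport hf x
    refine ⟨smear α f x, ?_, ker φ, hφ.integrable_ker, ?_, ?_, ?_⟩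
    · refine G.pos_subset_bigIdeal (G.mem_specC (F := Ioi 0) (hsp.trans hsub) fun γ hγ h => ?_)
      have hlam := G.pos
      rw [mem_Ioi] at hγ
      rcases h with h | h | h
      · linarith
      · linarith
      · exact h
    · rw [hφ.fourierT_ker_eq]
      exact hφ.2
    · rwa [hφ.fourierT_ker_eq]
    · exact (G.sys.smear_ker_eq_self hφ (h1.filter_mono (nhdsSet_mono hsp))).symm

lemma dense_bigIdeal (G : MaxGap α lam)
    (hJ : upIdeal (fun t => α (-t)) lam = upIdeal α lam) :
    closure ((bigIdeal α lam : Set X) + specC α (Ici 0)) = univ := by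
  have hM := G.sys.specM (isClosed_Ici (a := (0 : ℝ)))
  set N := (bigIdeal α lam ⊔ G.sys.specM (isClosed_Ici (a := (0 : ℝ)))).topologicalClosure with hN
  have hco : (N : Set X) = closure ((bigIdeal α lam : Set X) + specC α (Ici 0)) := by
    rw [hN, Submodule.topologicalClosure_coe, Submodule.coe_sup]
    rfl
  have hle : bigIdeal α lam ≤ N := le_sup_left.trans (Submodule.le_topologicalClosure _)
  have hle' : specC α (Ici 0) ⊆ N := fun x hx =>
    (le_sup_right.trans (Submodule.le_topologicalClosure _) :
      G.sys.specM (isClosed_Ici (a := (0 : ℝ))) ≤ N) hx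
  rw [← hco]
  refine eq_univ_of_forall fun x => ?_
  refine G.mem_of_forall (Submodule.isClosed_topologicalClosure _)
    (fun y hy => hle (G.neg_subset_bigIdeal hJ hy)) (fun y hy => hle' ?_)
    (fun y hy => hle (G.pos_subset_bigIdeal hy)) x
  rw [← G.sys.specC_zero] at hy
  exact specC_mono (by simp) hy

end MaxGap

end FullIdeal

/-! ### Hereditary subalgebras -/

section Hereditary

variable {α : ℝ → X → X} {lam : ℝ}

lemma mul_mul_mem_of_mem_cspan {S : Set X} {M : Submodule ℂ X} (hM : IsClosed (M : Set X))
    {a b : X} (h : ∀ s ∈ S, a * s * b ∈ M) {x : X} (hx : x ∈ cspan S) : a * x * b ∈ M :=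
  map_mem_of_mem_cspan hM
    (((ContinuousLinearMap.mul ℂ X).flip b).comp (ContinuousLinearMap.mul ℂ X a)) h hx

/-- A hereditary subalgebra of a closed ideal absorbs products from the middle. -/
lemma mul_mul_mem_of_hereditary {Y : Set X} (hY : IsClosedTwoSidedIdealIn univ Y)
    {B : Submodule ℂ X} (hB : IsHereditaryIn Y (B : Set X)) {b b' : X} (hb : b ∈ B)
    (hb' : b' ∈ B) (x : X) : b * x * b' ∈ B := by
  let _ : NonUnitalCStarAlgebra X := {}
  obtain ⟨hBY, -, ⟨⟨-, -, -, hmul⟩, hstar⟩, hher⟩ := hB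
  have hY' := hY.2.2.2.2.2
  have hsq : ∀ a ∈ B, ∀ x : X, a * x * star a ∈ B := by
    intro a ha x
    have hx : x ∈ Submodule.span ℂ {y : X | 0 ≤ y} := by
      rw [CStarAlgebra.span_nonneg]
      trivial
    refine Submodule.span_induction (p := fun x _ => a * x * star a ∈ B) (fun y hy => ?_) (by simp)
      (fun y z _ _ h1 h2 => by rw [mul_add, add_mul]; exact B.add_mem h1 h2)
      (fun c y _ h1 => by rw [mul_smul_comm, smul_mul_assoc]; exact B.smul_mem c h1) hx
    refine hher _ ((hY' _ trivial _ (hBY (hstar a ha))).1) (‖y‖ • (a * star a)) ?_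
      (star_right_conjugate_nonneg hy a)
      (CStarAlgebra.star_right_conjugate_le_norm_smul (IsSelfAdjoint.of_nonneg hy))
    rw [← Complex.coe_smul]
    exact B.smul_mem _ (hmul _ ha _ (hstar a ha))
  have hw := hstar b' hb'
  have key : b * x * b' = (2⁻¹ : ℂ) • ((b + star b') * x * star (b + star b') - b * x * star b
      - star b' * x * star (star b') + Complex.I • ((b + Complex.I • star b') * x *
        star (b + Complex.I • star b') - b * x * star b - star b' * x * star (star b'))) := by
    simp only [star_add, star_star, star_smul, add_mul, mul_add, smul_mul_assoc, mul_smul_comm,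
      smul_add, smul_sub, smul_smul]
    simp only [RCLike.star_def, Complex.conj_I, mul_neg, neg_mul, Complex.I_mul_I, neg_neg,
      mul_one]
    module
  rw [key]
  have hI := B.add_mem hb (B.smul_mem Complex.I hw)
  exact B.smul_mem _ (B.add_mem
    (B.sub_mem (B.sub_mem (hsq _ (B.add_mem hb hw) x) (hsq _ hb x)) (hsq _ hw x))
    (B.smul_mem _ (B.sub_mem (B.sub_mem (hsq _ hI x) (hsq _ hb x)) (hsq _ hw x))))

namespace MaxGap

lemma upIdeal_le_sandwich_nat (G : MaxGap α lam)
    (hJ : upIdeal (fun t => α (-t)) lam = upIdeal α lam) (k : ℕ) : upIdeal α lam ≤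
    cspan (MulSet3 (layer α lam (-k)) (upIdeal α lam : Set X) (layer α lam k)) := by
  induction k with
  | zero =>
    intro j hj
    have hz : ∀ e ∈ upIdeal α lam, e ∈ layer α lam 0 := fun e he => by
      rw [G.layer_zero]
      exact G.upIdeal_fixed he
    have hself : ∀ {z}, z ∈ upIdeal α lam → z ∈ cmul (upIdeal α lam : Set X) (upIdeal α lam) :=
      fun h => mem_cmul_self isClosed_upIdeal G.isStarSubalgebra_upIdeal h
    refine mem_of_mul_mem_left isClosed_upIdeal G.isStarSubalgebra_upIdeal (hself hj)
      (isClosed_cspan _) fun e he => ?_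
    refine mem_of_mul_mem_right isClosed_upIdeal G.isStarSubalgebra_upIdeal
      (hself (G.isStarSubalgebra_upIdeal.1.2.2.2 e he j hj)) (isClosed_cspan _) fun e' he' => ?_
    exact subset_cspan _ ⟨e, hz e he, j, hj, e', hz e' he', rfl⟩
  | succ k ih =>
    refine ih.trans (cspan_le (isClosed_cspan _) ?_)
    rintro _ ⟨a, ha, j, hj, b, hb, rfl⟩
    refine mul_mul_mem_of_mem_cspan (isClosed_cspan _) ?_
      (mem_cmul_self isClosed_upIdeal G.isStarSubalgebra_upIdeal hj)
    rintro _ ⟨j₁, h₁, j₂, h₂, rfl⟩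
    rw [SetLike.mem_coe, ← hJ, upIdeal_reverse] at h₁ h₂
    rw [show a * (j₁ * j₂) * b = a * j₁ * (j₂ * b) by simp only [mul_assoc]]
    refine mul_mul_mem_of_mem_cspan (isClosed_cspan _) ?_ h₁
    rintro _ ⟨p, hp, q, hq, rfl⟩
    rw [show a * (p * q) * (j₂ * b) = a * p * q * j₂ * b by simp only [mul_assoc]]
    refine mul_mul_mem_of_mem_cspan (isClosed_cspan _) ?_ h₂
    rintro _ ⟨p', hp', q', hq', rfl⟩
    rw [show a * p * q * (p' * q') * b = a * p * (q * p') * (q' * b) by simp only [mul_assoc]]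
    exact subset_cspan _ ⟨_, G.layer_mul (by push_cast; lia) ha hp, _, mul_mem_cmul hq hp', _,
      G.layer_mul (by push_cast; lia) hq' hb, rfl⟩

lemma upIdeal_le_sandwich (G : MaxGap α lam)
    (hJ : upIdeal (fun t => α (-t)) lam = upIdeal α lam) (k : ℤ) : upIdeal α lam ≤
    cspan (MulSet3 (layer α lam (-k)) (upIdeal α lam : Set X) (layer α lam k)) := by
  obtain ⟨n, rfl | rfl⟩ := k.eq_nat_or_neg
  · exact G.upIdeal_le_sandwich_nat hJ n
  · have h := G.reverse.upIdeal_le_sandwich_nat (by simpa using hJ.symm) n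
    rwa [hJ, layer_reverse, layer_reverse] at h

lemma mem_strongSpec (G : MaxGap α lam)
    (hJ : upIdeal (fun t => α (-t)) lam = upIdeal α lam) {B : Submodule ℂ X}
    (hBY : IsHereditaryIn (bigIdeal α lam : Set X) (B : Set X))
    (hinv : Invariant α (B : Set X)) (hne : ∃ b ∈ B, b ≠ 0) (k : ℤ) :
    (k * lam : ℝ) ∈ strongSpec α (B : Set X) := by
  intro ε hε
  have hBc := hBY.2.1
  have hBs := hBY.2.2.1
  have hbmul : ∀ {b b' : X}, b ∈ B → b' ∈ B → b * b' ∈ B := fun hb hb' => hBs.1.2.2.2 _ hb _ hb'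
  have hmid : ∀ {b b' : X}, b ∈ B → b' ∈ B → ∀ x, b * x * b' ∈ B := fun hb hb' x =>
    mul_mul_mem_of_hereditary (G.isIdeal_bigIdeal hJ) hBY hb hb' x
  set S := (B : Set X) ∩ specC α (Icc (k * lam - ε) (k * lam + ε)) with hS
  set H := cspan (MulSet3 (star '' S) (B : Set X) S) with hH
  have hHc : IsClosed (H : Set X) := isClosed_cspan _
  have hSlayer : ∀ {x}, x ∈ B → x ∈ layer α lam k → x ∈ S := fun hx hl =>
    ⟨hx, layer_subset α (by constructor <;> linarith) hl⟩
  have hSlayer' : ∀ {x}, x ∈ B → x ∈ layer α lam (-k) → x ∈ star '' S := fun {x} hx hl =>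
    ⟨star x, hSlayer (hBs.2 x hx) (G.star_layer (by simp) hl), star_star x⟩
  let C : Submodule ℂ X := B ⊓ G.sys.specM (isClosed_singleton (x := (0 : ℝ)))
  have hCf : ∀ {c}, c ∈ C → c ∈ fixedPts α := fun hc => by
    rw [← G.sys.specC_zero]; exact hc.2
  have hfC : ∀ {c}, c ∈ B → c ∈ fixedPts α → c ∈ C := fun hc hf => ⟨hc, G.fixed_mem hf⟩
  have hCc : IsClosed (C : Set X) := by
    rw [Submodule.coe_inf]
    exact hBc.inter (G.sys.isClosed_specC isClosed_singleton)
  have hCs : IsStarSubalgebra (C : Set X) := by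
    have hf := G.sys.isStarSubalgebra_fixedPts
    exact ⟨⟨C.zero_mem, fun _ hx _ hy => C.add_mem hx hy, fun c _ hx => C.smul_mem c hx,
      fun x hx y hy => hfC (hbmul hx.1 hy.1) (hf.1.2.2.2 x (hCf hx) y (hCf hy))⟩,
      fun x hx => hfC (hBs.2 x hx.1) (hf.2 x (hCf hx))⟩
  have hCJ : ∀ {c}, c ∈ C → c ∈ upIdeal α lam := fun hc =>
    G.mem_upIdeal_of_fixed (hBY.1 hc.1) (hCf hc)
  have hCC : ∀ {c}, c ∈ C → c ∈ cmul (C : Set X) C := fun hc => mem_cmul_self hCc hCs hc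
  have hlay : ∀ {m : ℤ} {c x}, c ∈ C → x ∈ layer α lam m → c * x ∈ layer α lam m :=
    fun hc hx => G.fixed_mul isClosed_singleton (hCf hc) hx
  have hlay' : ∀ {m : ℤ} {c x}, c ∈ C → x ∈ layer α lam m → x * c ∈ layer α lam m :=
    fun hc hx => G.mul_fixed isClosed_singleton (hCf hc) hx
  have hJmul := G.isStarSubalgebra_upIdeal.1.2.2.2
  set D := cspan (MulSet3 (upIdeal α lam : Set X) C (upIdeal α lam)) with hD
  have hDJ : D = upIdeal α lam := by
    refine G.upIdeal_simple (isClosed_cspan _) ?_ (fun s hs d hd => ⟨?_, ?_⟩) ?_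
    · refine cspan_le isClosed_upIdeal ?_
      rintro _ ⟨p, hp, c, hc, q, hq, rfl⟩
      exact hJmul _ (hJmul p hp c (hCJ hc)) q hq
    · refine mul_mem_of_mem_cspan_right (isClosed_cspan _) ?_ hd
      rintro _ ⟨p, hp, c, hc, q, hq, rfl⟩
      rw [← mul_assoc, ← mul_assoc]
      exact subset_cspan _ ⟨_, hJmul s hs p hp, c, hc, q, hq, rfl⟩
    · refine mul_mem_of_mem_cspan_left (isClosed_cspan _) ?_ hd
      rintro _ ⟨p, hp, c, hc, q, hq, rfl⟩
      rw [mul_assoc _ q]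
      exact subset_cspan _ ⟨p, hp, c, hc, _, hJmul q hq s hs, rfl⟩
    · obtain ⟨c, hcB, hcf, hc0⟩ := G.exists_fixed_ne_zero hBc hBs hinv hne
      have hc := hfC hcB hcf
      refine ⟨c, ?_, hc0⟩
      refine mem_of_mul_mem_left hCc hCs (hCC hc) (isClosed_cspan _) fun e he => ?_
      refine mem_of_mul_mem_right hCc hCs (hCC (hCs.1.2.2.2 e he c hc)) (isClosed_cspan _)
        fun e' he' => ?_
      exact subset_cspan _ ⟨e, hCJ he, c, hc, e', hCJ he', rfl⟩
  have hcjc : ∀ {c c' j}, c ∈ C → c' ∈ C → j ∈ upIdeal α lam → c * j * c' ∈ H := by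
    intro c c' j hc hc' hj
    refine mul_mul_mem_of_mem_cspan hHc ?_ (G.upIdeal_le_sandwich hJ k hj)
    rintro _ ⟨a, ha, j', hj', b, hb, rfl⟩
    rw [show c * (a * j' * b) * c' = c * a * j' * (b * c') by simp only [mul_assoc]]
    rw [← hDJ] at hj'
    refine mul_mul_mem_of_mem_cspan hHc ?_ hj'
    rintro _ ⟨p, hp, c₁, hc₁, q, hq, rfl⟩
    have hpl : c * (a * p) ∈ layer α lam (-k) :=
      hlay hc (G.mul_fixed isClosed_singleton (G.upIdeal_fixed hp) ha)
    have hql : (q * b) * c' ∈ layer α lam k :=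
      hlay' hc' (G.fixed_mul isClosed_singleton (G.upIdeal_fixed hq) hb)
    have hcl : IsClosed {z | c * (a * p) * z * (q * b * c') ∈ H} :=
      hHc.preimage (by fun_prop)
    have : c₁ ∈ {z | c * (a * p) * z * (q * b * c') ∈ H} := by
      refine mem_of_mul_mem_left hCc hCs (hCC hc₁) hcl fun e he => ?_
      refine mem_of_mul_mem_right hCc hCs (hCC (hCs.1.2.2.2 e he c₁ hc₁)) hcl fun e' he' => ?_
      refine subset_cspan _ ⟨c * (a * p) * e, hSlayer' (hmid hc.1 he.1 _) (hlay' he hpl), c₁,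
        hc₁.1, e' * (q * b) * c', hSlayer (hmid he'.1 hc'.1 _) ?_, by simp only [mul_assoc]⟩
      rw [mul_assoc]
      exact hlay he' hql
    have h' : c * (a * p) * c₁ * (q * b * c') ∈ H := this
    convert h' using 1
    simp only [mul_assoc]
  have hCH : ∀ {c}, c ∈ C → c ∈ H := fun {c} hc => by
    refine mem_of_mul_mem_left hCc hCs (hCC hc) hHc fun e he => ?_
    refine mem_of_mul_mem_right hCc hCs (hCC (hCs.1.2.2.2 e he c hc)) hHc fun e' he' => ?_
    exact hcjc he he' (hCJ hc)
  have hSB : ∀ {s}, s ∈ star '' S → s ∈ B := by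
    rintro _ ⟨s, hs, rfl⟩
    exact hBs.2 s hs.1
  change (H : Set X) = B
  refine Subset.antisymm ?_ fun b hb => ?_
  · refine cspan_le hBc ?_
    rintro _ ⟨s, hs, b, hb, t, ht, rfl⟩
    exact hbmul (hbmul (hSB hs) hb) ht.1
  · refine G.mem_of_fixed_mul_mem hBc hBs hinv hb hHc fun c hc hcf => ?_
    refine G.mem_of_mul_fixed_mem hBc hBs hinv (hbmul hc hb) hHc fun c' hc' hcf' => ?_
    rw [mul_assoc]
    refine mul_mem_of_mem_cspan_left hHc ?_ (hCH (hfC hc hcf))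
    rintro _ ⟨s, hs, b₁, hb₁, t, ht, rfl⟩
    rw [← mul_assoc]
    refine mul_mem_of_mem_cspan_right hHc ?_ (hCH (hfC hc' hcf'))
    rintro _ ⟨s', hs', b₂, hb₂, t', ht', rfl⟩
    refine subset_cspan _ ⟨s, hs, b₁ * t * b * s' * b₂,
      hbmul (hbmul (hbmul (hbmul hb₁ ht.1) hb) (hSB hs')) hb₂, t', ht', ?_⟩
    simp only [mul_assoc]

lemma actSpec_bigIdeal (G : MaxGap α lam)
    (hJ : upIdeal (fun t => α (-t)) lam = upIdeal α lam) :
    actSpec α (bigIdeal α lam : Set X) = ConnesSpec α (bigIdeal α lam : Set X) := by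
  obtain ⟨j, hj, hj0⟩ := G.upIdeal_ne
  have hjY := G.upIdeal_le_bigIdeal hj
  refine Subset.antisymm (fun γ hγ => ?_) (fun γ hγ ε hε h => ?_)
  · obtain ⟨k, rfl, -⟩ := G.exists_layer_of_mem_actSpec (bigIdeal α lam).zero_mem hγ
    refine mem_iInter₂.mpr fun B hB => ?_
    obtain ⟨hher, hB0, hinv⟩ := hB
    let B' : Submodule ℂ X :=
      { carrier := B
        zero_mem' := hher.2.2.1.1.1
        add_mem' := fun {a b} ha hb => hher.2.2.1.1.2.1 a ha b hb
        smul_mem' := fun c x hx => hher.2.2.1.1.2.2.1 c x hx }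
    refine G.mem_strongSpec hJ (B := B') hher hinv ?_ k
    by_contra hcon
    push Not at hcon
    refine hB0 (Subset.antisymm hcon ?_)
    rintro _ rfl
    exact B'.zero_mem
  · have h1 := mem_iInter₂.mp hγ (bigIdeal α lam : Set X)
      ⟨⟨Subset.rfl, isClosed_bigIdeal, G.isStarSubalgebra_bigIdeal hJ, fun x hx _ _ _ _ => hx⟩,
        fun h0 => hj0 (by rw [← mem_singleton_iff, ← h0]; exact hjY), G.bigIdeal_invariant⟩ ε hε
    rw [h] at h1
    have h2 : j ∈ cspan (MulSet3 (star '' ({0} : Set X)) (bigIdeal α lam : Set X) {0}) := by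
      rw [← SetLike.mem_coe, coe_cspan, h1]
      exact hjY
    have h3 : cspan (MulSet3 (star '' ({0} : Set X)) (bigIdeal α lam : Set X) {0}) ≤ ⊥ := by
      refine cspan_le (by simp) ?_
      rintro _ ⟨s, -, b, -, t, rfl, rfl⟩
      simp
    exact hj0 (by simpa using h3 h2)

lemma condition_of_eq (G : MaxGap α lam)
    (hJ : upIdeal (fun t => α (-t)) lam = upIdeal α lam) : Condition43 α :=
  Or.inr ⟨bigIdeal α lam, G.isIdeal_bigIdeal hJ, G.bigIdeal_invariant, G.alphaSimple_bigIdeal hJ,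
    G.specO_bigIdeal, G.actSpec_bigIdeal hJ, G.dense_bigIdeal hJ⟩

end MaxGap

end Hereditary

/-- **Lemma 4.11.** If `X^α([0,∞))` is a maximal norm-closed subalgebra of a nontrivial
one-parameter C*-dynamical system and `0` is an isolated point of `sp(α)`, then
Condition 4.3 holds. -/
theorem condition43_of_maximal_of_isolated (α : ℝ → X → X) (hα : IsCStarDynSys α)
    (hnontrivial : actSpec α (univ : Set X) ≠ ({0} : Set ℝ))
    (hmax : IsMaximalClosedSubalgebra (specC α (Ici (0 : ℝ))))
    (h0mem : (0 : ℝ) ∈ actSpec α (univ : Set X))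
    (h0iso : ∃ ε > (0 : ℝ), actSpec α (univ : Set X) ∩ Ioo (-ε) ε = ({0} : Set ℝ)) :
    Condition43 α := by
  obtain ⟨lam, G⟩ := exists_maxGap hα hnontrivial hmax h0mem h0iso
  rcases G.eq_or_annihilate with h | h
  · exact G.condition_of_eq h
  · exact G.condition_of_annihilate h h0mem

end PeligradMax
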